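/- arXiv:1501.01135 — 3 statements merged into one kernel-verified Lean document; each statement's English description precedes it below -/
import Mathlib

section
/- Let k and r be positive integers with r < k, and let p = (p_1,…,p_k) be a tuple of non-negative integers such that M_{p,r} is non-empty. Let S = (S_1,…,S_r) be a uniformly random element of M_{p,r}, and let f be a uniformly random surjection from [k−1] onto [r], independent of S. Then the probability that the random digraph G_α(S,f) is a tree equals 1 − p_k/r. -/
open Finset

/-- The cyclic interval `]i,j]` of `[k] = {1,…,k}`, realized inside `ZMod k`
(the element `k` of `[k]` is represented by `0 : ZMod k`). -/
def cyc (k : ℕ) [NeZero k] (i j : ZMod k) : Finset (ZMod k) :=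
  Finset.univ.filter fun x => 1 ≤ (x - i).val ∧ (x - i).val ≤ (j - i).val

/-- Membership in `𝒮_{p,r}` : each `j ∈ [k]` belongs to exactly `p j` of the sets `S_1,…,S_r`. -/
def SprMem (k r : ℕ) [NeZero k] (p : ZMod k → ℕ) (S : Fin r → Finset (ZMod k)) : Prop :=
  ∀ j : ZMod k, Nat.card {i : Fin r // j ∈ S i} = p j

/-- Membership in `ℳ_{p,r}` : member of `𝒮_{p,r}` all of whose sets are proper subsets of `[k]`. -/
def MprMem (k r : ℕ) [NeZero k] (p : ZMod k → ℕ) (S : Fin r → Finset (ZMod k)) : Prop :=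
  SprMem k r p S ∧ ∀ i, S i ≠ Finset.univ

/-- `|ℳ_{p,r}|`. -/
noncomputable def Mcard (k r : ℕ) [NeZero k] (p : ZMod k → ℕ) : ℕ :=
  Nat.card {S : Fin r → Finset (ZMod k) // MprMem k r p S}

/-- `|𝒮_{p,r}|`. -/
noncomputable def Scard (k r : ℕ) [NeZero k] (p : ZMod k → ℕ) : ℕ :=
  Nat.card {S : Fin r → Finset (ZMod k) // SprMem k r p S}

/-- `|ℳ_{q,r}|` for an integer-valued tuple `q` (empty if some entry of `q` is negative). -/
noncomputable def McardZ (k r : ℕ) [NeZero k] (q : ZMod k → ℤ) : ℕ :=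
  Nat.card {S : Fin r → Finset (ZMod k) //
    (∀ j : ZMod k, (Nat.card {i : Fin r // j ∈ S i} : ℤ) = q j) ∧ ∀ i, S i ≠ Finset.univ}

/-- `alphaRel k S i j` holds iff `j = α(i,S)`. -/
def alphaRel (k : ℕ) [NeZero k] (S : Finset (ZMod k)) (i j : ZMod k) : Prop :=
  if S = Finset.univ then j = i else j ∉ S ∧ cyc k i (j - 1) ⊆ S

/-- `betaRel k S i j` holds iff `j = β(i,S)`. -/
def betaRel (k : ℕ) [NeZero k] (S : Finset (ZMod k)) (i j : ZMod k) : Prop :=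
  if S = Finset.univ then j = i else j + 1 ∉ S ∧ cyc k i j ⊆ S

/-- `gammaRel k S i j` holds iff `j = γ(i,S)`. -/
def gammaRel (k : ℕ) [NeZero k] (S : Finset (ZMod k)) (i j : ZMod k) : Prop :=
  if S = Finset.univ then j = i
  else if i ∈ S then j = i - 1
  else j + 1 ∉ S ∧ cyc k i j ⊆ S

/-- The digraph on `[k]` with the `k-1` arcs `(i, ζ(i, S_{f i}))` for `i ∈ [k-1]`
(the nonzero elements of `ZMod k`) is a tree, i.e. a spanning tree oriented toward
the root `k` (represented by `0`): following the arcs from any vertex reaches the root. -/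
def GIsTree (k r : ℕ) [NeZero k] (zeta : Finset (ZMod k) → ZMod k → ZMod k → Prop)
    (S : Fin r → Finset (ZMod k)) (f : {i : ZMod k // i ≠ 0} → Fin r) : Prop :=
  ∃ g : ZMod k → ZMod k, g 0 = 0 ∧
    (∀ i : {i : ZMod k // i ≠ 0}, zeta (S (f i)) i.1 (g i.1)) ∧
    ∀ x : ZMod k, ∃ n : ℕ, g^[n] x = 0

/-- Sample space: pairs of a tuple `S ∈ ℳ_{p,r}` and a surjection `f : [k-1] → [r]`,
with the uniform probability measure. -/
abbrev OmM (k r : ℕ) [NeZero k] (p : ZMod k → ℕ) : Type :=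
  {om : (Fin r → Finset (ZMod k)) × ({i : ZMod k // i ≠ 0} → Fin r) //
    MprMem k r p om.1 ∧ Function.Surjective om.2}

/-- Sample space `Ω`: pairs of a tuple `S ∈ 𝒮_{p,r}` and a surjection `f : [k-1] → [r]`,
with the uniform probability measure. -/
abbrev OmS (k r : ℕ) [NeZero k] (p : ZMod k → ℕ) : Type :=
  {om : (Fin r → Finset (ZMod k)) × ({i : ZMod k // i ≠ 0} → Fin r) //
    SprMem k r p om.1 ∧ Function.Surjective om.2}

/-- Uniform probability of an event `A` in a (finite) sample space `Om`. -/
noncomputable def PrU {Om : Type} (A : Set Om) : ℚ :=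
  (Nat.card A : ℚ) / (Nat.card Om : ℚ)

/-- The `Pr`-determinant of a `k × k` matrix of events (rows and columns indexed by
`[k]`, i.e. by `ZMod k`). -/
noncomputable def Pdet {k : ℕ} [NeZero k] {Om : Type} (E : ZMod k → ZMod k → Set Om) : ℚ :=
  ∑ pi : Equiv.Perm (ZMod k), ((Equiv.Perm.sign pi : ℤ) : ℚ) * PrU (⋂ i : ZMod k, E i (pi i))

/-- The matrix of events `M_α`: `M_{α,i,j} = I^{f(i)}_{i,j}` for `i ∈ [k-1]`, and the
row of `i = k` (i.e. `0`) is constant equal to `Ω`. -/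
def Malpha (k r : ℕ) [NeZero k] (p : ZMod k → ℕ) (i j : ZMod k) : Set (OmS k r p) :=
  {om : OmS k r p | ∀ hi : i ≠ 0, cyc k i j ⊆ om.1.1 (om.1.2 ⟨i, hi⟩)}

/-- The matrix of events `M_β`: `M_{β,i,j} = J^{f(i)}_{i,j+1}` for `i ∈ [k-1]`, and the
row of `i = k` (i.e. `0`) is constant equal to `Ω`. -/
def Mbeta (k r : ℕ) [NeZero k] (p : ZMod k → ℕ) (i j : ZMod k) : Set (OmS k r p) :=
  {om : OmS k r p | ∀ hi : i ≠ 0,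
    if i = j + 1 then om.1.1 (om.1.2 ⟨i, hi⟩) = Finset.univ
    else cyc k i (j + 1) ⊆ om.1.1 (om.1.2 ⟨i, hi⟩)}

/-- Membership of `om` in the event `J^{f(i)}_{a,b}`. -/
def Jmem (k r : ℕ) [NeZero k] (p : ZMod k → ℕ) (om : OmS k r p)
    (i : {i : ZMod k // i ≠ 0}) (a b : ZMod k) : Prop :=
  if a = b then om.1.1 (om.1.2 i) = Finset.univ else cyc k a b ⊆ om.1.1 (om.1.2 i)

section Alternating

variable {ι V : Type} [DecidableEq ι]

/-- A function of tuples that changes sign when two entries are exchanged. -/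
def IsAlt (F : (ι → V) → ℤ) : Prop :=
  ∀ (x : ι → V) (i j : ι), i ≠ j → F (x ∘ Equiv.swap i j) = -F x

/-- The sum of the values of `F` at the tuples obtained by replacing one entry by `a`. -/
def insertSum [Fintype ι] (a : V) (F : (ι → V) → ℤ) (x : ι → V) : ℤ :=
  ∑ i, F (Function.update x i a)

lemma IsAlt.eq_zero {F : (ι → V) → ℤ} (hF : IsAlt F) {x : ι → V} {i j : ι} (hij : i ≠ j)
    (h : x i = x j) : F x = 0 := by
  have h1 := hF x i j hij
  have h2 : x ∘ Equiv.swap i j = x := by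
    ext l
    simp only [Function.comp, Equiv.swap_apply_def]
    split_ifs with h3 h4
    · rw [h3, h]
    · rw [h4, h]
    · rfl
  rw [h2] at h1
  lia

variable [Fintype ι]

lemma IsAlt.insertSum {F : (ι → V) → ℤ} (hF : IsAlt F) (a : V) : IsAlt (insertSum a F) := by
  intro x i j hij
  unfold _root_.insertSum
  rw [← Finset.sum_neg_distrib, ← Equiv.sum_comp (Equiv.swap i j)]
  refine Finset.sum_congr rfl fun l _ => ?_
  rw [← hF _ i j hij, Function.update_comp_equiv]
  simp

lemma IsAlt.insertSum_insertSum {F : (ι → V) → ℤ} (hF : IsAlt F) (a b : V) (x : ι → V) :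
    _root_.insertSum a (_root_.insertSum b F) x = _root_.insertSum b F x := by
  unfold _root_.insertSum
  have key : ∑ i, ∑ l ∈ univ.erase i,
      F (Function.update (Function.update x i a) l b) = 0 := by
    have hswap : ∑ i, ∑ l ∈ univ.erase i, F (Function.update (Function.update x i a) l b) =
        ∑ l, ∑ i ∈ univ.erase l, F (Function.update (Function.update x i a) l b) :=
      Finset.sum_comm' (by intro i l; simp [ne_comm])
    have hneg : ∑ i, ∑ l ∈ univ.erase i, F (Function.update (Function.update x i a) l b) =
        -∑ l, ∑ i ∈ univ.erase l, F (Function.update (Function.update x i a) l b) := by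
      simp only [← Finset.sum_neg_distrib]
      refine Finset.sum_congr rfl fun i _ => Finset.sum_congr rfl fun l hl => ?_
      have hli : l ≠ i := Finset.ne_of_mem_erase hl
      rw [← hF _ l i hli]
      congr 1
      ext m
      simp only [Function.comp, Function.update_apply, Equiv.swap_apply_def]
      grind
    lia
  calc _ = ∑ i, (F (Function.update x i b) +
        ∑ l ∈ univ.erase i, F (Function.update (Function.update x i a) l b)) := by
        refine Finset.sum_congr rfl fun i _ => ?_
        rw [← Finset.add_sum_erase _ _ (Finset.mem_univ i), Function.update_idem]
    _ = _ := by rw [Finset.sum_add_distrib, key, add_zero]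

end Alternating

section Labels

variable {V : Type} [DecidableEq V]

/-- A label carried past a column: it is kept if it lies in `T` and becomes `a` otherwise. -/
def jump (T : Finset V) (a v : V) : V := if v ∈ T then v else a

/-- The composition of the maps `jump (T j) (a j)` for `j = 0, …, n - 1`, in this order. -/
def run : ∀ {n : ℕ}, (Fin n → Finset V) → (Fin n → V) → V → V
  | 0, _, _, v => v
  | _ + 1, T, a, v => run (Fin.tail T) (Fin.tail a) (jump (T 0) (a 0) v)

/-- The restriction of `h` to `K`, as a partial self-map, has no cycle. -/
def NoCycle (K : Finset V) (h : V → V) : Prop :=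
  ∀ Z : Finset V, Z ⊆ K → (∀ z ∈ Z, h z ∈ Z) → Z = ∅

lemma run_const {n : ℕ} (T : Fin n → Finset V) (b v : V) :
    run T (fun _ => b) v = if ∀ j, v ∈ T j then v else b := by
  induction n generalizing v with
  | zero => simp [run]
  | succ n ih =>
    simp only [run, Fin.tail_def, ih, jump, Fin.forall_fin_succ]
    grind

lemma noCycle_run_const {n : ℕ} (K : Finset V) (T : Fin n → Finset V) (b : V) :
    NoCycle K (run T fun _ => b) ↔ b ∉ K ∧ ¬ ∃ v, v ∈ K ∧ ∀ j, v ∈ T j := by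
  constructor
  · intro h
    refine ⟨fun hb => ?_, fun ⟨v, hv, hvT⟩ => ?_⟩
    · simpa using h {b} (by simpa using hb) (by simp [run_const])
    · simpa using h {v} (by simpa using hv) (by simp [run_const, hvT])
  · rintro ⟨hb, hv⟩ Z hZ hinv
    by_contra hne
    obtain ⟨z, hz⟩ := Finset.nonempty_iff_ne_empty.2 hne
    have h1 := hinv z hz
    rw [run_const] at h1
    split_ifs at h1 with h2
    · exact hv ⟨z, hZ hz, h2⟩
    · exact hb (hZ h1)

lemma run_of_mem {n : ℕ} (T : Fin n → Finset V) (a : Fin n → V) (v : V) (hv : ∀ j, v ∈ T j) :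
    run T a v = v := by
  induction n with
  | zero => rfl
  | succ n ih =>
    rw [run, jump, if_pos (hv 0)]
    exact ih _ _ fun j => hv j.succ

lemma run_forward {n : ℕ} (T : Fin n → Finset V) (a : Fin n → V) (P : ℕ → V → Prop)
    (h : ∀ (j : Fin n) v, P j v → P (j + 1) (jump (T j) (a j) v)) (v : V) (hv : P 0 v) :
    P n (run T a v) := by
  induction n generalizing v P with
  | zero => exact hv
  | succ n ih =>
    exact ih (Fin.tail T) (Fin.tail a) (fun j => P (j + 1)) (fun j => h j.succ) _ (h 0 v hv)

lemma run_backward {n : ℕ} (T : Fin n → Finset V) (a : Fin n → V) (Q : V → Prop) :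
    ∃ R : ℕ → V → Prop, (∀ v, R n v ↔ Q v) ∧ (∀ v, R 0 v ↔ Q (run T a v)) ∧
      ∀ (j : Fin n) v, R j v ↔ R (j + 1) (jump (T j) (a j) v) := by
  induction n with
  | zero => exact ⟨fun _ => Q, by simp, by simp [run], fun j => j.elim0⟩
  | succ n ih =>
    obtain ⟨R, h1, h2, h3⟩ := ih (Fin.tail T) (Fin.tail a)
    refine ⟨fun m v => m.casesOn (Q (run T a v)) fun m => R m v, h1, by simp, fun j => ?_⟩
    refine Fin.cases (fun v => ?_) (fun j v => ?_) j
    · exact (h2 _).symm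
    · exact h3 j v

lemma IsAlt.apply_jump {ι : Type} [Fintype ι] [DecidableEq ι] {F : (ι → V) → ℤ}
    (hF : IsAlt F) (T : Finset V) (a : V) (x : ι → V) :
    F (jump T a ∘ x) = (if univ.image x ⊆ T then 1 else 0) * F x +
      ∑ i, ((if (univ.erase i).image x ⊆ T then 1 else 0) -
        (if univ.image x ⊆ T then 1 else 0)) * F (Function.update x i a) := by
  by_cases h : univ.image x ⊆ T
  · have h1 : jump T a ∘ x = x := by
      ext i
      simp [jump, h (Finset.mem_image_of_mem x (Finset.mem_univ i))]
    have h2 (i : ι) : (univ.erase i).image x ⊆ T :=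
      (Finset.image_subset_image (Finset.erase_subset _ _)).trans h
    simp [h, h1, h2]
  · simp only [h, if_false, zero_mul, zero_add, sub_zero]
    obtain ⟨i, hi⟩ : ∃ i, x i ∉ T := by
      simpa [Finset.image_subset_iff] using h
    have hoff (l : ι) (hl : l ≠ i) : ¬ (univ.erase l).image x ⊆ T := fun hs =>
      hi (hs (Finset.mem_image_of_mem x (by simp [hl.symm])))
    rw [Finset.sum_eq_single i (fun l _ hl => by simp [hoff l hl]) (by simp)]
    by_cases h3 : (univ.erase i).image x ⊆ T
    · rw [if_pos h3, one_mul]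
      congr 1
      ext l
      by_cases hl : l = i
      · subst hl; simp [jump, hi]
      · have : x l ∈ T := h3 (Finset.mem_image_of_mem x (by simp [hl]))
        simp [jump, hl, this]
    · rw [if_neg h3, zero_mul]
      obtain ⟨l, hl, hlT⟩ : ∃ l, l ≠ i ∧ x l ∉ T := by
        simpa [Finset.image_subset_iff] using h3
      exact hF.eq_zero hl (by simp [jump, hi, hlT])

variable [Fintype V]

/-- The weighted number of supersets of `X` depends only on the size of `X`. -/
lemma exists_superset_sum (w : ℕ → ℤ) : ∃ c : ℕ → ℤ, ∀ X : Finset V,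
    ∑ T : Finset V, w T.card * (if X ⊆ T then 1 else 0) = c X.card := by
  have hfac : Function.FactorsThrough
      (fun X : Finset V => ∑ T : Finset V, w T.card * (if X ⊆ T then 1 else 0))
      (Finset.card : Finset V → ℕ) := by
    intro X Y hXY
    obtain ⟨e⟩ : Nonempty ({v // v ∈ X} ≃ {v // v ∈ Y}) := by
      rw [← Fintype.card_eq]; simpa using hXY
    let σ : Equiv.Perm V := e.extendSubtype
    have hσ : X.map σ.toEmbedding = Y := by
      refine Finset.eq_of_subset_of_card_le (fun v hv => ?_) (by simp [hXY])
      obtain ⟨u, hu, rfl⟩ := Finset.mem_map.1 hv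
      exact e.extendSubtype_mem u hu
    refine Fintype.sum_equiv σ.finsetCongr _ _ fun T => ?_
    rw [← hσ]
    simp
  obtain ⟨c, hc⟩ := (Function.factorsThrough_iff _).1 hfac
  exact ⟨c, fun X => congrFun hc X⟩

lemma exists_jump_sum (w : ℕ → ℤ) (m : ℕ) : ∃ c d : ℤ,
    ∀ {ι : Type} [Fintype ι] [DecidableEq ι], Fintype.card ι = m →
    ∀ (F : (ι → V) → ℤ), IsAlt F → ∀ (a : V) (x : ι → V),
      ∑ T : Finset V, w T.card * F (jump T a ∘ x) = c * F x + d * insertSum a F x := by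
  obtain ⟨c, hc⟩ := exists_superset_sum (V := V) w
  refine ⟨c m, c (m - 1) - c m, ?_⟩
  intro ι _ _ hm F hF a x
  by_cases hx : Function.Injective x
  · have h1 : (univ.image x).card = m := by
      rw [Finset.card_image_of_injective _ hx, Finset.card_univ, hm]
    have h2 (i : ι) : ((univ.erase i).image x).card = m - 1 := by
      rw [Finset.card_image_of_injective _ hx, Finset.card_erase_of_mem (Finset.mem_univ i),
        Finset.card_univ, hm]
    simp only [hF.apply_jump, mul_add, Finset.sum_add_distrib, Finset.mul_sum]
    rw [Finset.sum_comm]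
    congr 1
    · rw [← h1, ← hc, Finset.sum_mul]
      exact Finset.sum_congr rfl fun T _ => by ring
    · rw [insertSum, Finset.mul_sum]
      refine Finset.sum_congr rfl fun i _ => ?_
      rw [← h2 i, ← hc, ← h1, ← hc, ← Finset.sum_sub_distrib, Finset.sum_mul]
      exact Finset.sum_congr rfl fun T _ => by ring
  · obtain ⟨i, j, h, hij⟩ : ∃ i j, x i = x j ∧ i ≠ j := by
      simpa [Function.Injective] using hx
    rw [hF.eq_zero hij h, (hF.insertSum a).eq_zero hij h]
    simp only [mul_zero, add_zero]
    exact Finset.sum_eq_zero fun T _ => by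
      rw [hF.eq_zero hij (by simp [h]), mul_zero]

lemma sum_fin_cons {α : Type} [Fintype α] [DecidableEq α] {n : ℕ} (G : (Fin (n + 1) → α) → ℤ) :
    ∑ T, G T = ∑ t, ∑ T, G (Fin.cons t T) := by
  rw [← (Fin.consEquiv fun _ => α).sum_comp, Fintype.sum_prod_type]
  rfl

lemma exists_run_sum (m : ℕ) : ∀ {n : ℕ} (w : Fin n → ℕ → ℤ), ∃ (A : ℤ) (B : Fin n → ℤ),
    ∀ {ι : Type} [Fintype ι] [DecidableEq ι], Fintype.card ι = m →
    ∀ (F : (ι → V) → ℤ), IsAlt F → ∀ (a : Fin n → V) (x : ι → V),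
      ∑ T : Fin n → Finset V, (∏ j, w j (T j).card) * F (run T a ∘ x) =
        A * F x + ∑ j, B j * insertSum (a j) F x := by
  intro n
  induction n with
  | zero =>
    intro w
    refine ⟨1, fun _ => 0, ?_⟩
    intro ι _ _ _ F _ a x
    have (T : Fin 0 → Finset V) : run T a ∘ x = x := rfl
    simp [this]
  | succ n ih =>
    intro w
    obtain ⟨A, B, h⟩ := ih (Fin.tail w)
    obtain ⟨c, d, hcd⟩ := exists_jump_sum (V := V) (w 0) m
    refine ⟨A * c, Fin.cons (A * d) (fun j => B j * (c + d)), ?_⟩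
    intro ι _ _ hm F hF a x
    have h1 (t : Finset V) (T : Fin n → Finset V) :
        run (Fin.cons t T : Fin (n + 1) → Finset V) a ∘ x =
          run T (Fin.tail a) ∘ (jump t (a 0) ∘ x) := by
      ext i
      simp [run]
    rw [sum_fin_cons]
    simp only [h1, Fin.prod_univ_succ, Fin.cons_zero, Fin.cons_succ, Fin.sum_univ_succ, mul_assoc]
    simp only [← Finset.mul_sum]
    have h2 (t : Finset V) : ∑ T : Fin n → Finset V, (∏ j, w j.succ (T j).card) *
        F (run T (Fin.tail a) ∘ (jump t (a 0) ∘ x)) =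
        A * F (jump t (a 0) ∘ x) + ∑ j, B j * insertSum (a j.succ) F (jump t (a 0) ∘ x) :=
      h hm F hF (Fin.tail a) (jump t (a 0) ∘ x)
    simp only [h2, mul_add, Finset.sum_add_distrib, Finset.mul_sum]
    rw [Finset.sum_comm (s := univ (α := Finset V))]
    have h3 := hcd hm F hF (a 0) x
    have h4 (b : V) := hcd hm _ (hF.insertSum b) (a 0) x
    simp only [hF.insertSum_insertSum] at h4
    simp only [mul_left_comm _ A, mul_left_comm _ (B _), ← Finset.mul_sum, h3, h4]
    rw [mul_add, add_assoc]
    congr 2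
    refine Finset.sum_congr rfl fun j _ => ?_
    ring

/-- The sign of `y` if it is a permutation, and `0` otherwise. -/
def mapSign (y : V → V) : ℤ := Matrix.det (Matrix.of fun i j => if y i = j then (1 : ℤ) else 0)

lemma mapSign_id : mapSign (id : V → V) = 1 := by
  rw [mapSign, ← Matrix.det_one (n := V)]
  congr 1
  ext i j
  simp [Matrix.one_apply]

lemma mapSign_swap (y : V → V) {i j : V} (hij : i ≠ j) :
    mapSign (y ∘ Equiv.swap i j) = -mapSign y := by
  have := Matrix.det_permute (Equiv.swap i j) (Matrix.of fun i j => if y i = j then (1 : ℤ) else 0)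
  rw [Equiv.Perm.sign_swap hij] at this
  simpa [mapSign, Matrix.submatrix] using this

lemma mapSign_update (i a : V) : mapSign (Function.update id i a) = if a = i then 1 else 0 := by
  split_ifs with h
  · subst h
    rw [← mapSign_id (V := V)]
    congr 1
    exact Function.update_eq_self a id
  · refine Matrix.det_zero_of_row_eq h (funext fun l => ?_)
    simp [Function.update_of_ne h]

/-- The map that agrees with `x` on `X` and with the identity elsewhere. -/
def extendId (X : Finset V) (x : X → V) (v : V) : V := if h : v ∈ X then x ⟨v, h⟩ else v

lemma isAlt_mapSign_extendId (X : Finset V) : IsAlt fun x : X → V => mapSign (extendId X x) := by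
  intro x i j hij
  change mapSign (extendId X (x ∘ Equiv.swap i j)) = -mapSign (extendId X x)
  rw [← mapSign_swap (i := i.1) (j := j.1) _ (fun h => hij (Subtype.ext h))]
  congr 1
  ext v
  simp only [extendId, Function.comp, Equiv.swap_apply_def]
  grind

lemma insertSum_mapSign_extendId (X : Finset V) (a : V) :
    insertSum a (fun x : X → V => mapSign (extendId X x)) (fun v => v.1) =
      if a ∈ X then 1 else 0 := by
  have h (i : X) : extendId X (Function.update (fun v : X => v.1) i a) =
      Function.update id i.1 a := by
    ext v
    simp only [extendId, Function.update_apply, id]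
    grind
  simp only [insertSum, h, mapSign_update]
  split_ifs with ha
  · rw [Finset.sum_eq_single ⟨a, ha⟩]
    · simp
    · rintro ⟨b, hb⟩ _ hne
      rw [if_neg]
      rintro rfl
      exact hne rfl
    · simp
  · refine Finset.sum_eq_zero fun i _ => if_neg ?_
    rintro rfl
    exact ha i.2

open Classical in
lemma noCycle_eq_det (K : Finset V) (h : V → V) :
    (if NoCycle K h then (1 : ℤ) else 0) =
      Matrix.det (Matrix.of fun i j : V =>
        (if i = j then (1 : ℤ) else 0) + (if i ∈ K ∧ h i = j then -1 else 0)) := by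
  split_ifs with hn
  · symm
    have hfix (i : V) : ¬ (i ∈ K ∧ h i = i) := fun hi => by
      simpa using hn {i} (by simpa using hi.1) (by simpa using hi.2)
    rw [Matrix.det_apply, Finset.sum_eq_single 1]
    · simp [hfix]
    · intro σ _ hσ
      by_contra hne
      have hprod := right_ne_zero_of_smul hne
      rw [Finset.prod_ne_zero_iff] at hprod
      have hmem (z : V) (hz : σ z ≠ z) : σ z ∈ K ∧ h (σ z) = z := by
        have := hprod z (Finset.mem_univ z)
        by_contra hc
        simp [hz, hc] at this
      have hinv := hn (univ.filter fun z => σ z ≠ z) (fun z hz => ?_) (fun z hz => ?_)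
      · refine hσ (Equiv.ext fun z => ?_)
        by_contra hz
        have : z ∈ univ.filter fun z => σ z ≠ z := by simpa using hz
        simp [hinv] at this
      all_goals
        have hz' : σ z ≠ z := by simpa using hz
        have h1 := hmem (σ.symm z) (by
          simp only [Equiv.apply_symm_apply]
          intro h2
          exact hz' (by conv_lhs => rw [h2, Equiv.apply_symm_apply]))
        simp only [Equiv.apply_symm_apply] at h1
      · exact h1.1
      · rw [h1.2]
        simp only [Finset.mem_filter, Finset.mem_univ, true_and, Equiv.apply_symm_apply]
        intro h2
        exact hz' (by conv_lhs => rw [h2, Equiv.apply_symm_apply])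
    · simp
  · symm
    have hZ : ∃ Z : Finset V, Z ⊆ K ∧ (∀ z ∈ Z, h z ∈ Z) ∧ Z ≠ ∅ := by
      simpa [NoCycle] using hn
    obtain ⟨Z, hZK, hZh, hZne⟩ := hZ
    obtain ⟨z, hz⟩ := Finset.nonempty_iff_ne_empty.2 hZne
    refine Matrix.exists_mulVec_eq_zero_iff.1
      ⟨fun v => if ∀ m : ℕ, h^[m] v ∈ K then 1 else 0, fun h0 => ?_, ?_⟩
    · have hit (m : ℕ) : h^[m] z ∈ Z := by
        induction m with
        | zero => exact hz
        | succ m ih => rw [Function.iterate_succ_apply']; exact hZh _ ih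
      have := congrFun h0 z
      simp [fun m => hZK (hit m)] at this
    · ext i
      simp only [Matrix.mulVec, dotProduct, Matrix.of_apply, add_mul, Finset.sum_add_distrib,
        ite_mul, one_mul, zero_mul, Finset.sum_ite_eq, Finset.mem_univ, if_true, Pi.zero_apply]
      by_cases hi : i ∈ K
      · have : (∀ m : ℕ, h^[m] i ∈ K) ↔ ∀ m : ℕ, h^[m] (h i) ∈ K := by
          constructor
          · intro H m
            exact H (m + 1)
          · rintro H (_ | m)
            · exact hi
            · exact H m
        simp only [hi, this, true_and, neg_mul, one_mul, Finset.sum_ite_eq, Finset.mem_univ,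
          if_true]
        lia
      · have : ¬ ∀ m : ℕ, h^[m] i ∈ K := fun H => hi (H 0)
        simp [hi, this]

open Classical in
lemma noCycle_eq_sum (K : Finset V) (h : V → V) :
    (if NoCycle K h then (1 : ℤ) else 0) =
      ∑ X : Finset V, (-1) ^ X.card * ((if X ⊆ K then 1 else 0) *
        mapSign (extendId X (h ∘ fun v : X => v.1))) := by
  have hrow : (Matrix.of fun i j : V =>
      (if i = j then (1 : ℤ) else 0) + (if i ∈ K ∧ h i = j then -1 else 0)) =
      (Matrix.of fun i j : V => if i ∈ K ∧ h i = j then (-1 : ℤ) else 0) +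
        Matrix.of fun i j : V => if i = j then (1 : ℤ) else 0 := by
    ext i j
    simp [add_comm]
  have hadd := (Matrix.detRowAlternating (n := V) (R := ℤ)).toMultilinearMap.map_add_univ
    (Matrix.of fun i j : V => if i ∈ K ∧ h i = j then (-1 : ℤ) else 0)
    (Matrix.of fun i j : V => if i = j then (1 : ℤ) else 0)
  rw [noCycle_eq_det, hrow]
  refine hadd.trans (Finset.sum_congr rfl fun X _ => ?_)
  have hscale : X.piecewise
      (Matrix.of fun i j : V => if i ∈ K ∧ h i = j then (-1 : ℤ) else 0)
      (Matrix.of fun i j : V => if i = j then (1 : ℤ) else 0) = fun i =>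
      (if i ∈ X then (-1) * (if i ∈ K then 1 else 0) else (1 : ℤ)) •
        (fun j => if extendId X (h ∘ fun v : X => v.1) i = j then (1 : ℤ) else 0) := by
    funext i j
    by_cases hi : i ∈ X <;> by_cases hK : i ∈ K <;>
      simp [Finset.piecewise, hi, hK, extendId]
  rw [hscale, MultilinearMap.map_smul_univ, smul_eq_mul, ← mul_assoc]
  congr 1
  rw [Finset.prod_ite_mem, Finset.univ_inter, Finset.prod_mul_distrib, Finset.prod_const,
    Finset.prod_boole]
  rfl

/-- The weighted number of pairs `(K, T)` for which the restriction of `run T a` to `K` has no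
cycle. -/
noncomputable def noCycleSum {n : ℕ} (w₀ : ℕ → ℤ) (w : Fin n → ℕ → ℤ) (a : Fin n → V) : ℤ :=
  open Classical in
  ∑ K : Finset V, ∑ T : Fin n → Finset V,
    w₀ K.card * (∏ j, w j (T j).card) * (if NoCycle K (run T a) then 1 else 0)

lemma sum_mem_eq (g : ℕ → ℤ) (a b : V) :
    ∑ X : Finset V, g X.card * (if a ∈ X then 1 else 0) =
      ∑ X : Finset V, g X.card * (if b ∈ X then 1 else 0) := by
  refine Fintype.sum_equiv (Equiv.swap a b).finsetCongr _ _ fun X => ?_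
  simp [Finset.mem_map_equiv]

lemma noCycleSum_eq {n : ℕ} (w₀ : ℕ → ℤ) (w : Fin n → ℕ → ℤ) (a b : Fin n → V) :
    noCycleSum w₀ w a = noCycleSum w₀ w b := by
  obtain ⟨c, hc⟩ := exists_superset_sum (V := V) w₀
  choose A B hAB using fun m => exists_run_sum (V := V) m w
  have key (a : Fin n → V) : noCycleSum w₀ w a =
      ∑ X : Finset V, (-1) ^ X.card * c X.card * A X.card +
        ∑ j, ∑ X : Finset V, (-1) ^ X.card * c X.card * B X.card j * (if a j ∈ X then 1 else 0) := by
    unfold noCycleSum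
    simp only [noCycle_eq_sum, Finset.mul_sum]
    rw [Finset.sum_comm (s := univ (α := Fin n)), ← Finset.sum_add_distrib]
    simp only [Finset.sum_comm (t := univ (α := Finset V)) (s := univ (α := Fin n → Finset V))]
    rw [Finset.sum_comm]
    refine Finset.sum_congr rfl fun X _ => ?_
    have h1 := hAB X.card (by simp) _ (isAlt_mapSign_extendId X) a (fun v : X => v.1)
    have h2 : extendId X (fun v : X => v.1) = id := by
      ext v
      simp [extendId]
    simp only [insertSum_mapSign_extendId, h2, mapSign_id] at h1
    calc _ = ∑ K : Finset V, (w₀ K.card * (if X ⊆ K then 1 else 0)) * ((-1) ^ X.card *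
          ∑ T : Fin n → Finset V, (∏ j, w j (T j).card) *
            mapSign (extendId X (run T a ∘ fun v : X => v.1))) := by
          refine Finset.sum_congr rfl fun K _ => ?_
          simp only [Finset.mul_sum]
          exact Finset.sum_congr rfl fun T _ => by ring
      _ = _ := by
          rw [← Finset.sum_mul, hc, h1]
          simp only [mul_add, Finset.mul_sum]
          congr 1
          · ring
          · exact Finset.sum_congr rfl fun j _ => by ring
  rw [key, key]
  congr 1
  exact Finset.sum_congr rfl fun j _ =>
    sum_mem_eq (fun m => (-1) ^ m * c m * B m j) (a j) (b j)

open Classical in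
lemma card_mul_noCycleSum {n : ℕ} (w₀ : ℕ → ℤ) (w : Fin n → ℕ → ℤ) (a : Fin n → V) :
    Fintype.card V * noCycleSum w₀ w a =
      ∑ K : Finset V, ∑ T : Fin n → Finset V, w₀ K.card * (∏ j, w j (T j).card) *
        ((Fintype.card V - K.card) * if ∃ v, v ∈ K ∧ ∀ j, v ∈ T j then 0 else 1) := by
  have h1 : (Fintype.card V : ℤ) * noCycleSum w₀ w a =
      ∑ b : V, noCycleSum w₀ w fun _ : Fin n => b := by
    simp [fun b => noCycleSum_eq w₀ w (fun _ : Fin n => b) a]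
  rw [h1]
  unfold noCycleSum
  rw [Finset.sum_comm]
  refine Finset.sum_congr rfl fun K _ => ?_
  rw [Finset.sum_comm]
  refine Finset.sum_congr rfl fun T _ => ?_
  rw [← Finset.mul_sum]
  congr 1
  have h2 : (Fintype.card V : ℤ) - K.card = ∑ b : V, if b ∈ K then 0 else 1 := by
    have := Finset.card_compl_add_card K
    have h3 : ∑ b : V, (if b ∈ K then (0 : ℤ) else 1) = (Kᶜ).card := by
      simp [Finset.sum_ite, Finset.compl_eq_univ_sdiff, Finset.filter_notMem_eq_sdiff]
    rw [h3, ← this]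
    push_cast
    ring
  rw [h2, Finset.sum_mul]
  refine Finset.sum_congr rfl fun b _ => ?_
  simp only [noCycle_run_const]
  split_ifs <;> simp_all

end Labels

lemma exists_alphaRel (k : ℕ) [NeZero k] (S : Finset (ZMod k)) (hS : S ≠ univ) (i : ZMod k) :
    ∃ m : ℕ, i + 1 + m ∉ S ∧ (∀ l < m, i + 1 + (l : ZMod k) ∈ S) ∧
      ∀ j, alphaRel k S i j ↔ j = i + 1 + m := by
  classical
  have hex : ∃ m : ℕ, i + 1 + (m : ZMod k) ∉ S := by
    obtain ⟨v, hv⟩ : ∃ v, v ∉ S := by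
      by_contra! h
      exact hS (Finset.eq_univ_iff_forall.2 h)
    refine ⟨(v - (i + 1)).val, ?_⟩
    rw [ZMod.natCast_zmod_val]
    simpa using hv
  have hspec := Nat.find_spec hex
  have hmin : ∀ l < Nat.find hex, i + 1 + (l : ZMod k) ∈ S := fun l hl => by
    simpa using Nat.find_min hex hl
  have hlt : Nat.find hex < k := by
    by_contra! h
    have := hmin (Nat.find hex - k) (by have := NeZero.pos k; lia)
    rw [Nat.cast_sub h] at this
    simp at this
    exact hspec this
  generalize Nat.find hex = m at hspec hmin hlt
  refine ⟨m, hspec, hmin, fun j => ?_⟩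
  simp only [alphaRel, if_neg hS]
  constructor
  · rintro ⟨hj, hsub⟩
    have hjd : j = i + 1 + ((j - 1 - i).val : ZMod k) := by
      rw [ZMod.natCast_zmod_val]; ring
    have hle : (j - 1 - i).val = m := by
      rcases lt_trichotomy (j - 1 - i).val m with h | h | h
      · exact absurd (hmin _ h) (hjd ▸ hj)
      · exact h
      · refine absurd (hsub ?_) hspec
        have hk := ZMod.val_lt (j - 1 - i)
        have : i + 1 + (m : ZMod k) - i = ((m + 1 : ℕ) : ZMod k) := by push_cast; ring
        simp only [cyc, Finset.mem_filter, Finset.mem_univ, true_and]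
        rw [this, ZMod.val_cast_of_lt (by lia)]
        lia
    rw [hle] at hjd
    exact hjd
  · rintro rfl
    refine ⟨hspec, fun x hx => ?_⟩
    have : i + 1 + (m : ZMod k) - 1 - i = m := by ring
    simp only [cyc, Finset.mem_filter, Finset.mem_univ, true_and, this,
      ZMod.val_cast_of_lt hlt] at hx
    have h1 := hmin ((x - i).val - 1) (by lia)
    rw [Nat.cast_sub hx.1, ZMod.natCast_zmod_val] at h1
    simpa using h1

lemma exists_alpha (k : ℕ) [NeZero k] (S : Finset (ZMod k)) (hS : S ≠ univ) :
    ∃ α : ZMod k → ZMod k, (∀ i j, alphaRel k S i j ↔ j = α i) ∧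
      (∀ i, i + 1 ∈ S → α i = α (i + 1)) ∧ (∀ i, i + 1 ∉ S → α i = i + 1) ∧
      ∀ P Q : ZMod k → Prop, (∀ i, P i → i + 1 ∈ S → P (i + 1)) →
        (∀ i, P i → i + 1 ∉ S → Q (i + 1)) → ∀ i, P i → Q (α i) := by
  choose m hm hlt hrel using exists_alphaRel k S hS
  refine ⟨fun i => i + 1 + m i, hrel, fun i hi => ?_, fun i hi => ?_, fun P Q hP hQ i hPi => ?_⟩
  · rcases Nat.lt_trichotomy (m i) (m (i + 1) + 1) with h | h | h
    · rcases hmi : m i with _ | l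
      · exact absurd hi (by simpa [hmi] using hm i)
      · have h1 := hlt (i + 1) l (by lia)
        have h2 := hm i
        rw [hmi] at h2
        push_cast at h2
        exact absurd h1 (by convert h2 using 2; ring)
    · simp only [h]; push_cast; ring
    · have h1 := hlt i _ h
      push_cast at h1
      exact absurd h1 (by convert hm (i + 1) using 2; ring)
  · rcases hmi : m i with _ | l
    · simp [hmi]
    · exact absurd (by simpa using hlt i 0 (by lia)) hi
  · have hind : ∀ l ≤ m i, P (i + l) := by
      intro l
      induction l with
      | zero => intro _; simpa using hPi
      | succ l ih =>
        intro hl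
        have h1 := hP _ (ih (by lia)) (by convert hlt i l (by lia) using 1; ring)
        convert h1 using 1
        push_cast; ring
    have h1 := hQ _ (hind (m i) le_rfl) (by convert hm i using 2; ring)
    convert h1 using 1
    ring

lemma natCast_succ_ne_zero {n : ℕ} (j : Fin n) : ((j.1 + 1 : ℕ) : ZMod (n + 1)) ≠ 0 := fun h => by
  have := congrArg ZMod.val h
  rw [ZMod.val_cast_of_lt (by lia)] at this
  simp at this

lemma gIsTree_iff_noCycle {n r : ℕ} (S : Fin r → Finset (ZMod (n + 1)))
    (hS : ∀ a, S a ≠ univ) (f : {i : ZMod (n + 1) // i ≠ 0} → Fin r)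
    (K : Finset (Fin r)) (T : Fin n → Finset (Fin r)) (b : Fin n → Fin r)
    (hK : ∀ a, a ∈ K ↔ 0 ∈ S a)
    (hT : ∀ j a, a ∈ T j ↔ ((j.1 + 1 : ℕ) : ZMod (n + 1)) ∈ S a)
    (hb : ∀ (j : Fin n) (h : ((j.1 + 1 : ℕ) : ZMod (n + 1)) ≠ 0),
      b j = f ⟨((j.1 + 1 : ℕ) : ZMod (n + 1)), h⟩) :
    GIsTree (n + 1) r (alphaRel (n + 1)) S f ↔ NoCycle K (run T b) := by
  classical
  choose α hrel hin hout hind using fun a => exists_alpha (n + 1) (S a) (hS a)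
  have hne (j : Fin n) : ((j.1 + 1 : ℕ) : ZMod (n + 1)) ≠ 0 := natCast_succ_ne_zero j
  constructor
  · rintro ⟨g, -, hg, hroot⟩ Z hZK hZ
    by_contra hZne
    obtain ⟨z, hz⟩ := Finset.nonempty_iff_ne_empty.2 hZne
    obtain ⟨R, hRn, hR0, hR⟩ := run_backward T b (· ∈ Z)
    -- `U` is a set of vertices closed under `g` and avoiding the root.
    let U : ZMod (n + 1) → Prop := fun v => ∃ h : v ≠ 0, R v.val (f ⟨v, h⟩)
    have hlast (v : ZMod (n + 1)) (hv : v + 1 = 0) : v.val = n := by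
      rw [eq_neg_of_add_eq_zero_left hv, ZMod.val_neg_one]
    have hstep (v : ZMod (n + 1)) (hv : v + 1 ≠ 0) :
        ∃ j : Fin n, j.1 = v.val ∧ v + 1 = ((j.1 + 1 : ℕ) : ZMod (n + 1)) := by
      have h1 := ZMod.val_lt v
      have h2 : v.val ≠ n := fun h => hv (by
        rw [← ZMod.natCast_zmod_val v, h]
        exact_mod_cast ZMod.natCast_self (n + 1))
      exact ⟨⟨v.val, by lia⟩, rfl, by simp⟩
    have hmove (a : Fin r) : ∀ i : ZMod (n + 1), R i.val a → U (α a i) := by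
      refine hind a (fun i => R i.val a) U (fun i hi hS => ?_) (fun i hi hS => ?_)
      · by_cases h0 : i + 1 = 0
        · rw [hlast i h0, hRn] at hi
          rw [h0, ZMod.val_zero, hR0]
          exact hZ a hi
        · obtain ⟨j, hj, hj'⟩ := hstep i h0
          rw [← hj, hR, jump, if_pos ((hT j a).2 (hj' ▸ hS))] at hi
          rwa [hj', ZMod.val_cast_of_lt (by lia)]
      · by_cases h0 : i + 1 = 0
        · rw [hlast i h0, hRn] at hi
          exact absurd ((hK a).1 (hZK hi)) (h0 ▸ hS)
        · obtain ⟨j, hj, hj'⟩ := hstep i h0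
          rw [← hj, hR, jump, if_neg (fun h => hS (hj' ▸ (hT j a).1 h)), hb j (hne j)] at hi
          rw [hj']
          exact ⟨hne j, by rwa [ZMod.val_cast_of_lt (by lia)]⟩
    have hclosed (v : ZMod (n + 1)) (hv : U v) : U (g v) := by
      obtain ⟨h0, hv⟩ := hv
      rw [(hrel _ _ _).1 (hg ⟨v, h0⟩)]
      exact hmove _ _ hv
    have hstart : U (α z 0) := hmove z 0 (by rw [ZMod.val_zero, hR0]; exact hZ z hz)
    obtain ⟨m, hm⟩ := hroot (α z 0)
    have hiter : ∀ m, U (g^[m] (α z 0)) := by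
      intro m
      induction m with
      | zero => exact hstart
      | succ m ih => rw [Function.iterate_succ_apply']; exact hclosed _ ih
    exact (hiter m).1 hm
  · intro hno
    let g : ZMod (n + 1) → ZMod (n + 1) := fun v => if h : v ≠ 0 then α (f ⟨v, h⟩) v else 0
    have hg (v : ZMod (n + 1)) (h : v ≠ 0) : g v = α (f ⟨v, h⟩) v := dif_pos h
    refine ⟨g, by simp [g], fun i => (hrel _ _ _).2 (hg i.1 i.2), ?_⟩
    by_contra! hbad
    obtain ⟨u, hu⟩ := hbad
    let U : ZMod (n + 1) → Prop := fun v => ∀ m, g^[m] v ≠ 0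
    have hU0 : ¬ U 0 := fun h => h 0 rfl
    have hUg (v : ZMod (n + 1)) (hv : U v) : U (g v) := fun m => hv (m + 1)
    let P : ℕ → Fin r → Prop := fun j a => U (α a (j : ZMod (n + 1)))
    have hP (j : Fin n) (a : Fin r) (h : P j a) : P (j + 1) (jump (T j) (b j) a) := by
      have hj : ((j.1 : ℕ) : ZMod (n + 1)) + 1 = ((j.1 + 1 : ℕ) : ZMod (n + 1)) := by simp
      simp only [P, jump] at h ⊢
      split_ifs with hmem
      · rw [hin a _ (hj ▸ (hT j a).1 hmem), hj] at h
        exact h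
      · rw [hout a _ (fun h => hmem ((hT j a).2 (hj ▸ h))), hj] at h
        rw [hb j (hne j), ← hg _ (hne j)]
        exact hUg _ h
    have hend (a : Fin r) (h : P n a) : 0 ∈ S a ∧ U (α a 0) := by
      have hn : (n : ZMod (n + 1)) + 1 = 0 := by exact_mod_cast ZMod.natCast_self (n + 1)
      have h0 : 0 ∈ S a := by
        by_contra h0
        simp only [P] at h
        rw [hout a _ (hn ▸ h0), hn] at h
        exact hU0 h
      refine ⟨h0, ?_⟩
      simp only [P] at h
      rwa [hin a _ (hn ▸ h0), hn] at h
    have hZ := hno (univ.filter fun a => 0 ∈ S a ∧ U (α a 0)) (fun a ha => ?_) (fun a ha => ?_)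
    · have hu0 : u ≠ 0 := hu 0
      have hpush : ∀ d, u.val + d ≤ n → ∃ a, P (u.val + d) a := by
        intro d
        induction d with
        | zero =>
          intro _
          refine ⟨f ⟨u, hu0⟩, ?_⟩
          simp only [P, add_zero, ZMod.natCast_zmod_val]
          rw [← hg u hu0]
          exact hUg u hu
        | succ d ih =>
          intro hd
          obtain ⟨a, ha⟩ := ih (by lia)
          exact ⟨_, hP ⟨u.val + d, by lia⟩ a ha⟩
      have hun := ZMod.val_lt u
      obtain ⟨a, ha⟩ := hpush (n - u.val) (by lia)
      rw [show u.val + (n - u.val) = n by lia] at ha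
      have : a ∈ univ.filter fun a => 0 ∈ S a ∧ U (α a 0) := by simpa using hend a ha
      simp [hZ] at this
    · exact (hK a).2 (Finset.mem_filter.1 ha).2.1
    · have := run_forward T b P hP a (by simpa [P] using (Finset.mem_filter.1 ha).2.2)
      simpa using hend _ this

/-- A tuple of sets of columns, seen as a tuple of sets of labels. -/
def transposeEquiv (V W : Type) [Fintype V] [DecidableEq V] [Fintype W] [DecidableEq W] :
    (V → Finset W) ≃ (W → Finset V) where
  toFun S j := univ.filter fun a => j ∈ S a
  invFun T a := univ.filter fun j => a ∈ T j
  left_inv S := by ext; simp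
  right_inv T := by ext; simp

lemma forall_zmod_succ {n : ℕ} (Q : ZMod (n + 1) → Prop) :
    (∀ j, Q j) ↔ Q 0 ∧ ∀ j : Fin n, Q ((j.1 + 1 : ℕ) : ZMod (n + 1)) := by
  refine ⟨fun h => ⟨h 0, fun j => h _⟩, fun ⟨h0, h⟩ j => ?_⟩
  rcases hj : j.val with _ | m
  · rwa [(ZMod.val_eq_zero j).1 hj]
  · have hlt := ZMod.val_lt j
    rw [← ZMod.natCast_zmod_val j, hj]
    exact h ⟨m, by lia⟩

/-- A tuple of subsets of `[n + 1]` is given by the labels of the sets containing each element. -/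
lemma exists_columnEquiv (V : Type) [Fintype V] [DecidableEq V] (n : ℕ) :
    ∃ e : Finset V × (Fin n → Finset V) ≃ (V → Finset (ZMod (n + 1))),
      (∀ K T a, 0 ∈ e (K, T) a ↔ a ∈ K) ∧
      ∀ K T a (j : Fin n), ((j.1 + 1 : ℕ) : ZMod (n + 1)) ∈ e (K, T) a ↔ a ∈ T j := by
  let c : Finset V × (Fin n → Finset V) ≃ (ZMod (n + 1) → Finset V) :=
    Fin.consEquiv fun _ => Finset V
  have hsucc (j : Fin n) : ((j.1 + 1 : ℕ) : ZMod (n + 1)) = (j.succ : Fin (n + 1)) :=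
    ZMod.natCast_zmod_val (n := n + 1) j.succ
  have hmem (q) (a : V) (j : ZMod (n + 1)) :
      j ∈ (transposeEquiv V (ZMod (n + 1))).symm (c q) a ↔ a ∈ c q j := by
    simp [transposeEquiv]
  refine ⟨c.trans (transposeEquiv V (ZMod (n + 1))).symm, fun K T a => ?_, fun K T a j => ?_⟩
  · exact hmem (K, T) a 0
  · rw [hsucc]
    exact hmem (K, T) a (j.succ : Fin (n + 1))

lemma natCard_subtype_eq_sum {α : Type} [Fintype α] (P : α → Prop) [DecidablePred P] :
    (Nat.card {x // P x} : ℤ) = ∑ x, if P x then 1 else 0 := by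
  rw [Nat.card_eq_fintype_card, Fintype.card_subtype]
  simp

lemma card_mul_card_tree {n r : ℕ} (p : ZMod (n + 1) → ℕ)
    (f : {i : ZMod (n + 1) // i ≠ 0} → Fin r) :
    (r : ℤ) * Nat.card {S : Fin r → Finset (ZMod (n + 1)) //
        MprMem (n + 1) r p S ∧ GIsTree (n + 1) r (alphaRel (n + 1)) S f} =
      (r - p 0) * Nat.card {S : Fin r → Finset (ZMod (n + 1)) // MprMem (n + 1) r p S} := by
  classical
  obtain ⟨e, hmem0, hmem⟩ := exists_columnEquiv (Fin r) n
  have hne (j : Fin n) : ((j.1 + 1 : ℕ) : ZMod (n + 1)) ≠ 0 := natCast_succ_ne_zero j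
  let b : Fin n → Fin r := fun j => f ⟨((j.1 + 1 : ℕ) : ZMod (n + 1)), hne j⟩
  let w₀ : ℕ → ℤ := fun m => if m = p 0 then 1 else 0
  let w : Fin n → ℕ → ℤ := fun j m => if m = p ((j.1 + 1 : ℕ) : ZMod (n + 1)) then 1 else 0
  have hsum (G : (Fin r → Finset (ZMod (n + 1))) → ℤ) :
      ∑ S, G S = ∑ K : Finset (Fin r), ∑ T : Fin n → Finset (Fin r), G (e (K, T)) := by
    rw [← e.sum_comp, Fintype.sum_prod_type]
  have hspr (K : Finset (Fin r)) (T : Fin n → Finset (Fin r)) :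
      SprMem (n + 1) r p (e (K, T)) ↔
        K.card = p 0 ∧ ∀ j, (T j).card = p ((j.1 + 1 : ℕ) : ZMod (n + 1)) := by
    rw [SprMem, forall_zmod_succ]
    simp only [hmem0, hmem, Nat.card_eq_fintype_card, Fintype.card_coe]
  have hproper (K : Finset (Fin r)) (T : Fin n → Finset (Fin r)) :
      (∀ a, e (K, T) a ≠ univ) ↔
        ¬ ∃ v, v ∈ K ∧ ∀ j, v ∈ T j := by
    simp only [ne_eq, Finset.eq_univ_iff_forall, forall_zmod_succ, hmem0, hmem, not_exists]
  have hw (K : Finset (Fin r)) (T : Fin n → Finset (Fin r)) :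
      w₀ K.card * ∏ j, w j (T j).card =
        if K.card = p 0 ∧ ∀ j, (T j).card = p ((j.1 + 1 : ℕ) : ZMod (n + 1)) then 1 else 0 := by
    simp only [w₀, w, Finset.prod_boole, Finset.mem_univ, true_imp_iff]
    split_ifs <;> simp_all
  have htree : (Nat.card {S : Fin r → Finset (ZMod (n + 1)) //
      MprMem (n + 1) r p S ∧ GIsTree (n + 1) r (alphaRel (n + 1)) S f} : ℤ) =
      noCycleSum w₀ w b := by
    rw [natCard_subtype_eq_sum, hsum]
    refine Finset.sum_congr rfl fun K _ => Finset.sum_congr rfl fun T _ => ?_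
    rw [hw, ite_zero_mul_ite_zero, mul_one]
    refine if_congr ?_ rfl rfl
    have hiff (h : ∀ a, e (K, T) a ≠ univ) :=
      gIsTree_iff_noCycle _ h f K T b (fun a => (hmem0 K T a).symm)
        (fun j a => (hmem K T a j).symm) (fun _ _ => rfl)
    rw [MprMem, hspr, and_assoc]
    refine and_congr_right fun _ => ⟨fun h => (hiff h.1).1 h.2, fun h => ?_⟩
    have hp : ∀ a, e (K, T) a ≠ univ := by
      rw [hproper]
      rintro ⟨v, hv, hvT⟩
      simpa using h {v} (by simpa using hv) (by simp [run_of_mem T b v hvT])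
    exact ⟨hp, (hiff hp).2 h⟩
  have hcard := card_mul_noCycleSum w₀ w b
  rw [Fintype.card_fin] at hcard
  rw [htree, hcard, natCard_subtype_eq_sum, hsum, Finset.mul_sum]
  refine Finset.sum_congr rfl fun K _ => ?_
  rw [Finset.mul_sum]
  refine Finset.sum_congr rfl fun T _ => ?_
  simp only [hw, MprMem, hspr, hproper]
  split_ifs <;> simp_all

/-- Theorem 1(a): for `S` uniform on `ℳ_{p,r}` and `f` an independent uniform surjection
`[k-1] → [r]`, the probability that `G_α(S,f)` is a tree equals `1 - p_k / r`. -/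
theorem prob_tree_alpha (k r : ℕ) [NeZero k] (hr : 0 < r) (hrk : r < k)
    (p : ZMod k → ℕ)
    (hM : Nonempty {S : Fin r → Finset (ZMod k) // MprMem k r p S}) :
    (Nat.card {om : OmM k r p // GIsTree k r (alphaRel k) om.1.1 om.1.2} : ℚ) /
      (Nat.card (OmM k r p) : ℚ) = 1 - (p 0 : ℚ) / (r : ℚ) := by
  classical
  obtain ⟨n, rfl⟩ : ∃ n, k = n + 1 := ⟨k - 1, by lia⟩
  have hsurj : Nonempty {f : {i : ZMod (n + 1) // i ≠ 0} → Fin r // Function.Surjective f} := by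
    have hcard : Fintype.card (Fin r) ≤ Fintype.card {i : ZMod (n + 1) // i ≠ 0} := by
      rw [Fintype.card_subtype_compl, ZMod.card, Fintype.card_fin, Fintype.card_subtype_eq]
      lia
    obtain ⟨g⟩ := Function.Embedding.nonempty_of_card_le hcard
    have : Nonempty (Fin r) := ⟨⟨0, hr⟩⟩
    exact ⟨⟨Function.invFun g, Function.invFun_surjective g.injective⟩⟩
  have hOm : Nat.card (OmM (n + 1) r p) =
      Nat.card {S : Fin r → Finset (ZMod (n + 1)) // MprMem (n + 1) r p S} *
        Nat.card {f : {i : ZMod (n + 1) // i ≠ 0} → Fin r // Function.Surjective f} := by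
    rw [← Nat.card_prod]
    exact Nat.card_congr (Equiv.subtypeProdEquivProd)
  have hTree : Nat.card {om : OmM (n + 1) r p //
      GIsTree (n + 1) r (alphaRel (n + 1)) om.1.1 om.1.2} =
      ∑ f : {f : {i : ZMod (n + 1) // i ≠ 0} → Fin r // Function.Surjective f},
        Nat.card {S : Fin r → Finset (ZMod (n + 1)) //
          MprMem (n + 1) r p S ∧ GIsTree (n + 1) r (alphaRel (n + 1)) S f.1} := by
    rw [← Nat.card_sigma]
    exact Nat.card_congr
      { toFun := fun om => ⟨⟨om.1.1.2, om.1.2.2⟩, ⟨om.1.1.1, om.1.2.1, om.2⟩⟩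
        invFun := fun q => ⟨⟨(q.2.1, q.1.1), q.2.2.1, q.1.2⟩, q.2.2.2⟩
        left_inv := fun _ => rfl
        right_inv := fun _ => rfl }
  have hmul : (r : ℚ) * Nat.card {om : OmM (n + 1) r p //
      GIsTree (n + 1) r (alphaRel (n + 1)) om.1.1 om.1.2} =
      (r - p 0) * Nat.card (OmM (n + 1) r p) := by
    have hZ : (r : ℤ) * Nat.card {om : OmM (n + 1) r p //
        GIsTree (n + 1) r (alphaRel (n + 1)) om.1.1 om.1.2} =
        (r - p 0) * Nat.card (OmM (n + 1) r p) := by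
      rw [hTree, hOm, Nat.cast_sum, Finset.mul_sum]
      simp only [card_mul_card_tree]
      rw [Finset.sum_const, Finset.card_univ, ← Nat.card_eq_fintype_card]
      push_cast
      rw [nsmul_eq_mul]
      ring
    exact_mod_cast hZ
  have hpos : (Nat.card (OmM (n + 1) r p) : ℚ) ≠ 0 := by
    rw [hOm, Nat.cast_ne_zero]
    exact Nat.mul_ne_zero Nat.card_pos.ne' Nat.card_pos.ne'
  have hr0 : (r : ℚ) ≠ 0 := by exact_mod_cast hr.ne'
  rw [div_eq_iff hpos]
  field_simp
  linarith
end

section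
/- Let k and r be positive integers with r < k, and let p = (p_1,…,p_k) be a tuple of non-negative integers such that M_{p,r} is non-empty. Let S = (S_1,…,S_r) be a uniformly random element of M_{p,r}, and let f be a uniformly random surjection from [k−1] onto [r], independent of S. Then the probability that the random digraph G_β(S,f) is a tree equals |M_{q,r−1}| / |M_{p,r}|, where q = (p_1, p_2−1, p_3−1, …, p_k−1). -/
open Finset

/-- The transition matrix of a partial function. -/
def transMatrix {Ω : Type} [DecidableEq Ω] (R : Type) [Zero R] [One R] (h : Ω → Option Ω) :
    Matrix Ω Ω R :=
  Matrix.of fun s s' => if h s = some s' then 1 else 0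

theorem det_one_sub_transMatrix_of_wellFounded {Ω R : Type} [Fintype Ω] [DecidableEq Ω]
    [CommRing R] (h : Ω → Option Ω) (hwf : WellFounded fun s' s => h s = some s') :
    (1 - transMatrix R h).det = 1 := by
  classical
  have : IsWellFounded Ω fun s' s => h s = some s' := ⟨hwf⟩
  have hlt : ∀ {s s'}, h s = some s' → IsWellFounded.rank (fun s' s => h s = some s') s' <
      IsWellFounded.rank (fun s' s => h s = some s') s := fun {s s'} hs =>
    IsWellFounded.rank_lt_of_rel (r := fun s' s => h s = some s') hs
  have hbt : (1 - transMatrix R h).BlockTriangular fun s =>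
      OrderDual.toDual (IsWellFounded.rank (fun s' s => h s = some s') s) := by
    intro s s' hs
    have hs' := OrderDual.toDual_lt_toDual.1 hs
    have hne : s ≠ s' := by rintro rfl; exact lt_irrefl _ hs'
    have : h s ≠ some s' := fun h' => lt_asymm hs' (hlt h')
    simp [transMatrix, this, hne]
  rw [hbt.det]
  refine Finset.prod_eq_one fun a _ => ?_
  refine Eq.trans (congrArg _ ?_) Matrix.det_one
  ext ⟨s, hs⟩ ⟨s', hs'⟩
  have : h s ≠ some s' := fun h' => by
    have := hlt h'
    rw [← hs'] at hs
    exact this.ne' (OrderDual.toDual_inj.1 hs)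
  simp [Matrix.toSquareBlock_def, transMatrix, this, Matrix.one_apply]

theorem det_one_sub_transMatrix_of_not_wellFounded {Ω R : Type} [Fintype Ω] [DecidableEq Ω]
    [CommRing R] [IsDomain R] (h : Ω → Option Ω)
    (hwf : ¬ WellFounded fun s' s => h s = some s') :
    (1 - transMatrix R h).det = 0 := by
  classical
  rw [← Matrix.exists_mulVec_eq_zero_iff]
  refine ⟨fun s => if Acc (fun s' s => h s = some s') s then 0 else 1, ?_, ?_⟩
  · obtain ⟨s, hs⟩ : ∃ s, ¬ Acc (fun s' s => h s = some s') s := by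
      by_contra! hc
      exact hwf ⟨hc⟩
    intro h0
    simpa [hs] using congrFun h0 s
  · ext s
    rw [Matrix.sub_mulVec, Matrix.one_mulVec]
    have hacc : Acc (fun s' s => h s = some s') s ↔
        ∀ s', h s = some s' → Acc (fun s' s => h s = some s') s' :=
      ⟨fun ha s' hs => ha.inv hs, fun ha => ⟨_, ha⟩⟩
    cases hs : h s with
    | none =>
      have : Acc (fun s' s => h s = some s') s := hacc.2 (by simp [hs])
      simp [Matrix.mulVec, dotProduct, transMatrix, hs, this]
    | some u =>
      have : Acc (fun s' s => h s = some s') s ↔ Acc (fun s' s => h s = some s') u := by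
        rw [hacc]; simp [hs]
      simp only [Matrix.mulVec, dotProduct, transMatrix, hs, this, Matrix.of_apply, Option.some.injEq,
        ite_mul, one_mul, zero_mul, Finset.sum_ite_eq, mem_univ, if_true, Pi.sub_apply, sub_self,
        Pi.zero_apply]

/-- The matrix with diagonal `d` and with `-c` on the cyclically shifted diagonal. -/
def cyclicBidiag {k : ℕ} {R : Type} [Ring R] (d c : ZMod k → R) : Matrix (ZMod k) (ZMod k) R :=
  Matrix.of fun l m => (if m = l then d l else 0) - if m = l + 1 then c l else 0

theorem eq_one_or_eq_addRight {k : ℕ} [NeZero k] (σ : Equiv.Perm (ZMod k))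
    (hσ : ∀ l, σ l = l ∨ σ l = l + 1) : σ = 1 ∨ σ = Equiv.addRight 1 := by
  by_cases h : ∀ l, σ l = l
  · exact Or.inl (Equiv.ext h)
  · right
    push Not at h
    obtain ⟨a, ha⟩ := h
    have key : ∀ n : ℕ, σ (a + n) ≠ a + n := by
      intro n
      induction n with
      | zero => simpa using ha
      | succ n ih =>
        intro hc
        have h1 := (hσ (a + n)).resolve_left ih
        have h2 : σ (a + n) = σ (a + (n + 1 : ℕ)) := by
          rw [h1, hc]; push_cast; ring
        have h3 := σ.injective h2
        apply ih
        rw [h3, hc]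
    ext l
    refine (hσ l).resolve_left ?_
    have := key (l - a).val
    simpa using this

theorem det_cyclicBidiag {k : ℕ} [NeZero k] (hk : 1 < k) {R : Type} [CommRing R]
    (d c : ZMod k → R) : (cyclicBidiag d c).det = ∏ l, d l - ∏ l, c l := by
  have : Fact (1 < k) := ⟨hk⟩
  have h10 : (1 : ZMod k) ≠ 0 := one_ne_zero
  have hne : (1 : Equiv.Perm (ZMod k)) ≠ Equiv.addRight 1 := by
    intro h
    have := congrArg (fun σ : Equiv.Perm (ZMod k) => σ 0) h
    simp at this
  rw [← Matrix.det_transpose, Matrix.det_apply', Fintype.sum_eq_add _ _ hne]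
  · have hs : Equiv.Perm.sign (Equiv.addRight (1 : ZMod k)) = (-1) ^ (k - 1) := by
      obtain ⟨n, rfl⟩ : ∃ n, k = n + 1 := ⟨k - 1, by omega⟩
      rw [← sign_finRotate]
      congr 1
      ext i
      exact (finRotate_apply (n := n + 1) i).symm
    have hneg : (-1 : R) ^ (k - 1) * (-1) ^ k = -1 := by
      rw [← pow_add, Odd.neg_one_pow ⟨k - 1, by omega⟩]
    simp only [cyclicBidiag, Matrix.transpose_apply, Matrix.of_apply, hs, Equiv.coe_addRight,
      Equiv.Perm.sign_one, Equiv.Perm.one_apply, left_eq_add, add_eq_left, h10, if_true, if_false]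
    simp [Finset.prod_neg, ← mul_assoc, hneg, sub_eq_add_neg]
  · rintro σ ⟨h1, h2⟩
    have : ∃ l, ¬ (σ l = l ∨ σ l = l + 1) := by
      by_contra! hc
      rcases eq_one_or_eq_addRight σ hc with h | h
      · exact h1 h
      · exact h2 h
    obtain ⟨l, hl⟩ := this
    push Not at hl
    rw [Finset.prod_eq_zero (mem_univ l), mul_zero]
    simp [cyclicBidiag, hl.1, hl.2]

theorem det_kronecker_sub {n κ K : Type} [Fintype n] [DecidableEq n] [Fintype κ] [DecidableEq κ]
    [Nonempty κ] [Field K] (B : Matrix n n K) (hB : B.det ≠ 0) (e : n → K) (F : n → κ) :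
    (Matrix.of fun s s' : n × κ => (if s.2 = s'.2 then B s.1 s'.1 else 0) -
      if s' = (s.1, F s.1) then e s.1 else 0).det =
    B.det ^ (Fintype.card κ - 1) * (B - Matrix.diagonal e).det := by
  let BK : Matrix (n × κ) (n × κ) K := Matrix.kroneckerMap (· * ·) B (1 : Matrix κ κ K)
  let BI : Matrix (n × κ) (n × κ) K := Matrix.kroneckerMap (· * ·) B⁻¹ (1 : Matrix κ κ K)
  let A : Matrix (n × κ) n K := Matrix.of fun s j => if s.1 = j then e j else 0
  let E : Matrix n (n × κ) K := Matrix.of fun j s => if s = (j, F j) then 1 else 0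
  have hu : IsUnit B.det := isUnit_iff_ne_zero.2 hB
  have hBI : BK * BI = 1 := by
    simp only [BK, BI]
    rw [← Matrix.mul_kronecker_mul, Matrix.mul_nonsing_inv _ hu, one_mul, Matrix.one_kronecker_one]
  have hEBA : E * (BI * A) = B⁻¹ * Matrix.diagonal e := by
    ext i j
    simp [E, BI, A, Matrix.mul_apply, Fintype.sum_prod_type, Matrix.one_apply, Matrix.diagonal_apply]
  have hM : (Matrix.of fun s s' : n × κ => (if s.2 = s'.2 then B s.1 s'.1 else 0) -
      if s' = (s.1, F s.1) then e s.1 else 0) = BK * (1 - BI * A * E) := by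
    rw [mul_sub, mul_one, Matrix.mul_assoc BI, ← Matrix.mul_assoc BK, hBI, Matrix.one_mul]
    ext s s'
    simp only [BK, A, E, Matrix.mul_apply, Matrix.one_apply, Matrix.of_apply, Matrix.sub_apply,
      Matrix.kroneckerMap_apply, mul_ite, mul_one, mul_zero]
    rw [Finset.sum_eq_single s.1]
    · simp
    · intro j _ hj
      simp [hj.symm]
    · simp
  have hcard : Fintype.card κ = Fintype.card κ - 1 + 1 :=
    (Nat.sub_add_cancel Fintype.card_pos).symm
  have hBD : B - Matrix.diagonal e = B * (1 - B⁻¹ * Matrix.diagonal e) := by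
    rw [mul_sub, mul_one, ← mul_assoc, Matrix.mul_nonsing_inv _ hu, one_mul]
  rw [hM, Matrix.det_mul, Matrix.det_one_sub_mul_comm, hEBA, hBD, Matrix.det_mul, ← mul_assoc,
    ← pow_succ, ← hcard, Matrix.det_kronecker, Matrix.det_one, one_pow, mul_one]

theorem ZMod.val_sub_one_add_one {k : ℕ} [NeZero k] {y : ZMod k} (hy : y ≠ 0) :
    (y - 1).val + 1 = y.val := by
  have hk : k ≠ 1 := by
    rintro rfl
    exact hy (Subsingleton.elim _ _)
  have hpos : 1 ≤ y.val := Nat.one_le_iff_ne_zero.2 ((ZMod.val_ne_zero y).2 hy)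
  rw [ZMod.val_sub (by rwa [ZMod.val_one'' hk]), ZMod.val_one'' hk]
  omega

theorem betaRel_of_ne_univ {k : ℕ} [NeZero k] {S : Finset (ZMod k)} (hS : S ≠ univ)
    (i j : ZMod k) : betaRel k S i j ↔ j + 1 ∉ S ∧ cyc k i j ⊆ S := by
  simp [betaRel, hS]

theorem betaRel_iff_eq {k : ℕ} [NeZero k] {S : Finset (ZMod k)} {i j : ZMod k}
    (hi : i + 1 ∉ S) : betaRel k S i j ↔ j = i := by
  have hS : S ≠ univ := by
    rintro rfl
    exact hi (mem_univ _)
  rw [betaRel_of_ne_univ hS]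
  constructor
  · rintro ⟨-, hsub⟩
    by_contra hne
    have hne' : j - i ≠ 0 := sub_ne_zero.2 hne
    refine hi (hsub ?_)
    have hk : k ≠ 1 := by
      rintro rfl
      exact hne (Subsingleton.elim _ _)
    have := (ZMod.val_ne_zero _).2 hne'
    simp only [cyc, mem_filter, mem_univ, true_and, add_sub_cancel_left, ZMod.val_one'' hk]
    omega
  · rintro rfl
    refine ⟨hi, fun x hx => ?_⟩
    simp only [cyc, mem_filter, mem_univ, true_and, sub_self, ZMod.val_zero] at hx
    omega

theorem betaRel_iff_succ {k : ℕ} [NeZero k] {S : Finset (ZMod k)} (hS : S ≠ univ) {i j : ZMod k}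
    (hi : i + 1 ∈ S) : betaRel k S i j ↔ betaRel k S (i + 1) j := by
  rw [betaRel_of_ne_univ hS, betaRel_of_ne_univ hS]
  refine and_congr_right fun hj => ?_
  have hne : j - i ≠ 0 := by
    intro h
    rw [sub_eq_zero.1 h] at hj
    exact hj hi
  have hjv := ZMod.val_sub_one_add_one hne
  constructor
  · intro h x hx
    by_cases hxi : x - i = 0
    · simp only [cyc, mem_filter, mem_univ, true_and, ← sub_sub, hxi] at hx
      refine absurd hx.2 ?_
      have hm := ZMod.val_lt (j - i)
      have hneg : (0 - 1 : ZMod k).val + 1 = k := by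
        obtain ⟨n, rfl⟩ : ∃ n, k = n + 1 := ⟨k - 1, by have := NeZero.pos k; omega⟩
        rw [zero_sub, ZMod.val_neg_one]
      omega
    · have := ZMod.val_sub_one_add_one hxi
      apply h
      simp only [cyc, mem_filter, mem_univ, true_and, ← sub_sub] at hx ⊢
      omega
  · intro h x hx
    by_cases hxi : x - i = 0
    · simp [cyc, hxi] at hx
    · have hv := ZMod.val_sub_one_add_one hxi
      by_cases hxi' : x - i - 1 = 0
      · rw [sub_sub, sub_eq_zero] at hxi'
        rwa [hxi']
      · have := (ZMod.val_ne_zero _).2 hxi'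
        apply h
        simp only [cyc, mem_filter, mem_univ, true_and, ← sub_sub] at hx ⊢
        omega

theorem exists_betaRel {k : ℕ} [NeZero k] {S : Finset (ZMod k)} (hS : S ≠ univ) (i : ZMod k) :
    ∃ j, betaRel k S i j := by
  obtain ⟨e, he⟩ : ∃ e, e ∉ S := by
    by_contra! hc
    exact hS (eq_univ_iff_forall.2 hc)
  induction hm : (e - 1 - i).val generalizing i with
  | zero =>
    obtain rfl : e - 1 = i := sub_eq_zero.1 ((ZMod.val_eq_zero _).1 hm)
    exact ⟨_, (betaRel_iff_eq (by simpa using he)).2 rfl⟩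
  | succ m ih =>
    by_cases hi : i + 1 ∈ S
    · have hne : e - 1 - i ≠ 0 := by
        rw [← ZMod.val_ne_zero, hm]
        exact Nat.succ_ne_zero m
      have := ZMod.val_sub_one_add_one hne
      obtain ⟨j, hj⟩ := ih (i + 1) (by rw [← sub_sub]; omega)
      exact ⟨j, (betaRel_iff_succ hS hi).2 hj⟩
    · exact ⟨i, (betaRel_iff_eq hi).2 rfl⟩

/-- One step of a walker at position `l` carrying the label `t`: it advances while the next
position lies in `S t`, and otherwise it takes the label `F l`, or is absorbed if `l = 0`. -/
def walkStep {k r : ℕ} (F : ZMod k → Fin r) (s : ZMod k × Fin r) (b : Bool) :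
    Option (ZMod k × Fin r) :=
  if b then some (s.1 + 1, s.2) else if s.1 = 0 then none else some (s.1, F s.1)

/-- The step function of the walker determined by the tuple of sets `S`. -/
def walk {k r : ℕ} (F : ZMod k → Fin r) (S : Fin r → Finset (ZMod k))
    (s : ZMod k × Fin r) : Option (ZMod k × Fin r) :=
  walkStep F s (decide (s.1 + 1 ∈ S s.2))

/-- The walker is absorbed from every starting state. -/
def WalkAbsorbed {k r : ℕ} (F : ZMod k → Fin r) (S : Fin r → Finset (ZMod k)) : Prop :=
  WellFounded fun s' s => walk F S s = some s'

theorem walk_of_mem {k r : ℕ} (F : ZMod k → Fin r) {S : Fin r → Finset (ZMod k)}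
    {l : ZMod k} {t : Fin r} (h : l + 1 ∈ S t) : walk F S (l, t) = some (l + 1, t) := by
  simp [walk, walkStep, h]

theorem walk_of_notMem {k r : ℕ} (F : ZMod k → Fin r) {S : Fin r → Finset (ZMod k)}
    {l : ZMod k} {t : Fin r} (h : l + 1 ∉ S t) :
    walk F S (l, t) = if l = 0 then none else some (l, F l) := by
  simp [walk, walkStep, h]

theorem WalkAbsorbed.ne_univ {k r : ℕ} [NeZero k] {F : ZMod k → Fin r}
    {S : Fin r → Finset (ZMod k)} (hw : WalkAbsorbed F S) (t : Fin r) : S t ≠ univ := by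
  intro ht
  have key : ∀ s : ZMod k × Fin r, s.2 ≠ t := by
    intro s
    induction s using hw.induction with
    | _ s ih =>
      obtain ⟨l, u⟩ := s
      rintro rfl
      exact ih (l + 1, u) (walk_of_mem F (by rw [ht]; exact mem_univ _)) rfl
  exact key (0, t) rfl

theorem WalkAbsorbed.gIsTree {k r : ℕ} [NeZero k] {F : ZMod k → Fin r}
    {S : Fin r → Finset (ZMod k)} (hw : WalkAbsorbed F S) :
    GIsTree k r (betaRel k) S fun i => F i.1 := by
  choose b hb using fun s : ZMod k × Fin r => exists_betaRel (hw.ne_univ s.2) s.1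
  let g : ZMod k → ZMod k := fun x => if x = 0 then 0 else b (x, F x)
  have hg : ∀ i : ZMod k, i ≠ 0 → betaRel k (S (F i)) i (g i) := by
    intro i hi
    simpa [g, hi] using hb (i, F i)
  have key : ∀ s : ZMod k × Fin r, ∀ j, betaRel k (S s.2) s.1 j → ∃ n : ℕ, g^[n] j = 0 := by
    intro s
    induction s using hw.induction with
    | _ s ih =>
      obtain ⟨l, t⟩ := s
      intro j hj
      by_cases hl : l + 1 ∈ S t
      · exact ih (l + 1, t) (walk_of_mem F hl) j ((betaRel_iff_succ (hw.ne_univ t) hl).1 hj)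
      · obtain rfl := (betaRel_iff_eq hl).1 hj
        by_cases h0 : j = 0
        · exact ⟨0, h0⟩
        · obtain ⟨n, hn⟩ := ih (j, F j) (by rw [walk_of_notMem F hl, if_neg h0]) (g j) (hg j h0)
          exact ⟨n + 1, hn⟩
  refine ⟨g, by simp [g], fun i => hg i.1 i.2, fun x => ?_⟩
  by_cases hx : x = 0
  · exact ⟨0, hx⟩
  · obtain ⟨n, hn⟩ := key (x, F x) (g x) (hg x hx)
    exact ⟨n + 1, hn⟩

theorem acc_walk_of_betaRel {k r : ℕ} [NeZero k] {F : ZMod k → Fin r}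
    {S : Fin r → Finset (ZMod k)} {t : Fin r} (hS : S t ≠ univ) {j : ZMod k}
    (hacc : j ≠ 0 → Acc (fun s' s => walk F S s = some s') (j, F j)) (l : ZMod k)
    (hl : betaRel k (S t) l j) : Acc (fun s' s => walk F S s = some s') (l, t) := by
  induction hm : (j - l).val generalizing l with
  | zero =>
    obtain rfl : j = l := sub_eq_zero.1 ((ZMod.val_eq_zero _).1 hm)
    have hj := ((betaRel_of_ne_univ hS _ _).1 hl).1
    refine ⟨_, fun s' hs' => ?_⟩
    rw [walk_of_notMem F hj] at hs'
    split_ifs at hs' with h0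
    obtain rfl := Option.some.inj hs'
    exact hacc h0
  | succ m ih =>
    have hne : j - l ≠ 0 := by
      rw [← ZMod.val_ne_zero, hm]
      exact Nat.succ_ne_zero m
    have hmem : l + 1 ∈ S t := by
      by_contra hc
      exact hne (sub_eq_zero.2 ((betaRel_iff_eq hc).1 hl))
    refine ⟨_, fun s' hs' => ?_⟩
    rw [walk_of_mem F hmem] at hs'
    obtain rfl := Option.some.inj hs'
    refine ih (l + 1) ((betaRel_iff_succ hS hmem).1 hl) ?_
    have := ZMod.val_sub_one_add_one hne
    rw [← sub_sub]
    omega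

theorem walkAbsorbed_iff {k r : ℕ} [NeZero k] (F : ZMod k → Fin r)
    (S : Fin r → Finset (ZMod k)) :
    WalkAbsorbed F S ↔ (∀ t, S t ≠ univ) ∧ GIsTree k r (betaRel k) S fun i => F i.1 := by
  refine ⟨fun hw => ⟨hw.ne_univ, hw.gIsTree⟩, ?_⟩
  rintro ⟨hS, g, hg0, hg, hreach⟩
  have key : ∀ n : ℕ, ∀ x, g^[n] x = 0 → x ≠ 0 →
      Acc (fun s' s => walk F S s = some s') (x, F x) := by
    intro n
    induction n with
    | zero => exact fun x hx h0 => absurd hx h0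
    | succ n ih =>
      exact fun x hx h0 => acc_walk_of_betaRel (hS _) (ih (g x) hx) x (hg ⟨x, h0⟩)
  refine ⟨fun ⟨l, t⟩ => ?_⟩
  obtain ⟨j, hj⟩ := exists_betaRel (hS t) l
  obtain ⟨n, hn⟩ := hreach j
  exact acc_walk_of_betaRel (hS t) (key n j hn) l hj

/-- A tuple of sets, encoded by the bits read by the walker in each state. -/
def bitsEquiv (k r : ℕ) [NeZero k] :
    (Fin r → Finset (ZMod k)) ≃ (ZMod k × Fin r → Bool) where
  toFun S s := decide (s.1 + 1 ∈ S s.2)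
  invFun b t := univ.filter fun j => b (j - 1, t) = true
  left_inv S := by
    ext t j
    simp
  right_inv b := by
    ext s
    simp

theorem prod_bits {k r : ℕ} [NeZero k] {K : Type} [CommRing K] (z : ZMod k → K)
    (S : Fin r → Finset (ZMod k)) :
    ∏ s : ZMod k × Fin r, (if bitsEquiv k r S s = true then z (s.1 + 1) else 1) =
      ∏ t, ∏ j ∈ S t, z j := by
  rw [Fintype.prod_prod_type_right]
  refine Finset.prod_congr rfl fun t _ => ?_
  rw [← Fintype.prod_ite_mem (S t)]
  exact Fintype.prod_equiv (Equiv.addRight (1 : ZMod k)) _ _ fun l =>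
    if_congr (by simp [bitsEquiv]) rfl rfl

theorem sum_weight_mul_det {k r : ℕ} [NeZero k] {K : Type} [CommRing K] (F : ZMod k → Fin r)
    (z : ZMod k → K) :
    ∑ S : Fin r → Finset (ZMod k),
      (∏ t, ∏ j ∈ S t, z j) * (1 - transMatrix K (walk F S)).det =
    (Matrix.of fun s s' : ZMod k × Fin r =>
      (if s.2 = s'.2 then
        cyclicBidiag (fun l => 1 + z (l + 1)) (fun l => z (l + 1)) s.1 s'.1 else 0) -
      if s' = (s.1, F s.1) then (if s.1 = 0 then 0 else 1) else 0).det := by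
  let row : ZMod k × Fin r → Bool → ZMod k × Fin r → K := fun s b s' =>
    (1 : Matrix _ _ K) s s' - if walkStep F s b = some s' then 1 else 0
  let w : ZMod k × Fin r → Bool → K := fun s b => if b = true then z (s.1 + 1) else 1
  have hrow : (Matrix.of fun s s' : ZMod k × Fin r =>
      (if s.2 = s'.2 then
        cyclicBidiag (fun l => 1 + z (l + 1)) (fun l => z (l + 1)) s.1 s'.1 else 0) -
      if s' = (s.1, F s.1) then (if s.1 = 0 then 0 else 1) else 0) =
      fun s => ∑ b, w s b • row s b := by
    funext ⟨l, t⟩ ⟨l', t'⟩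
    simp only [Matrix.of_apply, cyclicBidiag, Fintype.sum_bool, w, row, walkStep, Matrix.one_apply,
      Pi.add_apply, Pi.smul_apply, smul_eq_mul, Prod.mk.injEq, if_true, Bool.false_eq_true,
      if_false, Option.some.injEq, one_mul, eq_comm (a := l'), eq_comm (a := t')]
    grind
  let D : MultilinearMap K (fun _ : ZMod k × Fin r => ZMod k × Fin r → K) K :=
    Matrix.detRowAlternating.toMultilinearMap
  refine Eq.trans ?_ (congrArg D hrow).symm
  rw [MultilinearMap.map_sum]
  refine Fintype.sum_equiv (bitsEquiv k r) _ _ fun S => ?_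
  rw [MultilinearMap.map_smul_univ, smul_eq_mul, ← prod_bits]
  rfl

theorem sum_weight_walkAbsorbed {k r : ℕ} [NeZero k] (hk : 1 < k) {K : Type} [Field K]
    (F : ZMod k → Fin r) (z : ZMod k → K) (hz : ∏ j, (1 + z j) ≠ ∏ j, z j) [NeZero r]
    [DecidablePred (WalkAbsorbed F)] :
    ∑ S : Fin r → Finset (ZMod k), (if WalkAbsorbed F S then ∏ t, ∏ j ∈ S t, z j else 0) =
      (∏ j, (1 + z j) - ∏ j, z j) ^ (r - 1) * ∏ j ∈ univ.erase 1, z j := by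
  have hshift : ∀ u : ZMod k → K, ∏ l, u (l + 1) = ∏ j, u j := fun u =>
    Fintype.prod_equiv (Equiv.addRight 1) _ _ fun l => rfl
  have hB : (cyclicBidiag (fun l => 1 + z (l + 1)) (fun l => z (l + 1))).det =
      ∏ j, (1 + z j) - ∏ j, z j := by
    rw [det_cyclicBidiag hk, hshift fun j => 1 + z j, hshift z]
  have hD : cyclicBidiag (fun l => 1 + z (l + 1)) (fun l => z (l + 1)) -
      Matrix.diagonal (fun l => if l = 0 then 0 else 1) =
      cyclicBidiag (fun l => (if l + 1 = 1 then 1 else 0) + z (l + 1)) (fun l => z (l + 1)) := by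
    ext l m
    by_cases h : l = m <;> by_cases h0 : l = 0 <;>
      simp [cyclicBidiag, Matrix.diagonal_apply, h, h0, Ne.symm] <;> grind
  have hD' : (cyclicBidiag (fun l => (if l + 1 = 1 then 1 else 0) + z (l + 1))
      (fun l => z (l + 1))).det = ∏ j ∈ univ.erase 1, z j := by
    rw [det_cyclicBidiag hk, hshift fun j => (if j = 1 then 1 else 0) + z j, hshift z,
      ← Finset.mul_prod_erase univ _ (mem_univ (1 : ZMod k)),
      ← Finset.mul_prod_erase univ z (mem_univ (1 : ZMod k)),
      Finset.prod_congr (g := z) rfl fun j hj => by simp [(Finset.mem_erase.1 hj).1]]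
    simp
    ring
  have hmain := sum_weight_mul_det F z
  rw [det_kronecker_sub _ (by rw [hB]; exact sub_ne_zero.2 hz) (fun l => if l = 0 then 0 else 1) F,
    hB, hD, hD', Fintype.card_fin] at hmain
  rw [← hmain]
  refine Finset.sum_congr rfl fun S _ => ?_
  split_ifs with hS
  · rw [det_one_sub_transMatrix_of_wellFounded _ hS, mul_one]
  · rw [det_one_sub_transMatrix_of_not_wellFounded _ hS, mul_zero]

/-- The number of sets of a tuple containing each element. -/
noncomputable def tupleMultiplicity {k m : ℕ} [NeZero k] (S : Fin m → Finset (ZMod k)) : ZMod k →₀ ℕ :=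
  Finsupp.equivFunOnFinite.symm fun j => #{t | j ∈ S t}

theorem tupleMultiplicity_apply {k m : ℕ} [NeZero k] (S : Fin m → Finset (ZMod k)) (j : ZMod k) :
    tupleMultiplicity S j = Nat.card {t // j ∈ S t} := by
  rw [Nat.card_eq_fintype_card, Fintype.card_subtype]
  rfl

theorem prod_prod_X_eq_monomial {k m : ℕ} [NeZero k] (S : Fin m → Finset (ZMod k)) :
    ∏ t, ∏ j ∈ S t, (MvPolynomial.X j : MvPolynomial (ZMod k) ℚ) =
      MvPolynomial.monomial (tupleMultiplicity S) 1 := by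
  rw [MvPolynomial.monomial_eq, Finsupp.prod_fintype _ _ (by simp), map_one, one_mul]
  rw [Finset.prod_congr rfl fun t _ => (Fintype.prod_ite_mem (S t) MvPolynomial.X).symm,
    Finset.prod_comm]
  refine Finset.prod_congr rfl fun j _ => ?_
  rw [Finset.prod_ite, Finset.prod_const, Finset.prod_const_one, mul_one]
  rfl

theorem sum_monomial_walkAbsorbed {k r : ℕ} [NeZero k] (hk : 1 < k) [NeZero r]
    (F : ZMod k → Fin r) [DecidablePred (WalkAbsorbed F)] :
    ∑ S : Fin r → Finset (ZMod k), (if WalkAbsorbed F S then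
        MvPolynomial.monomial (tupleMultiplicity S) (1 : ℚ) else 0) =
      (∑ S ∈ Fintype.piFinset fun _ : Fin (r - 1) => univ.erase univ,
        MvPolynomial.monomial (tupleMultiplicity S) 1) *
      ∏ j ∈ univ.erase 1, MvPolynomial.X j := by
  let A := MvPolynomial (ZMod k) ℚ
  let K := FractionRing A
  have hinj : Function.Injective (algebraMap A K) := IsFractionRing.injective A K
  have hne : ∏ j : ZMod k, (1 + MvPolynomial.X j : A) ≠ ∏ j, MvPolynomial.X j := by
    intro h
    have := congrArg (MvPolynomial.eval fun _ => (0 : ℚ)) h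
    simp [map_prod, NeZero.ne k] at this
  have hsum : ∏ j : ZMod k, (1 + MvPolynomial.X j : A) - ∏ j, MvPolynomial.X j =
      ∑ T ∈ univ.erase univ, ∏ j ∈ T, (MvPolynomial.X j : A) := by
    rw [Finset.prod_one_add, Finset.powerset_univ,
      ← Finset.add_sum_erase univ _ (mem_univ (univ : Finset (ZMod k))), add_sub_cancel_left]
  have hpow : (∏ j : ZMod k, (1 + MvPolynomial.X j : A) - ∏ j, MvPolynomial.X j) ^ (r - 1) =
      ∑ S ∈ Fintype.piFinset fun _ : Fin (r - 1) => univ.erase univ,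
        MvPolynomial.monomial (tupleMultiplicity S) 1 := by
    rw [hsum, Finset.sum_pow']
    exact Finset.sum_congr rfl fun S _ => prod_prod_X_eq_monomial S
  rw [← hpow]
  apply hinj
  have := sum_weight_walkAbsorbed hk F (fun j => algebraMap A K (MvPolynomial.X j)) (by
    intro h
    apply hne
    apply hinj
    simpa [map_prod] using h)
  simp only [map_sum, map_mul, map_pow, map_sub, map_prod, map_add, map_one, apply_ite, map_zero,
    ← prod_prod_X_eq_monomial]
  exact this

theorem card_walkAbsorbed {k r : ℕ} [NeZero k] (hk : 1 < k) [NeZero r] (F : ZMod k → Fin r)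
    (p : ZMod k → ℕ) :
    Nat.card {S : Fin r → Finset (ZMod k) // SprMem k r p S ∧ WalkAbsorbed F S} =
      McardZ k (r - 1) (fun j => if j = 1 then (p j : ℤ) else (p j : ℤ) - 1) := by
  classical
  let P : ZMod k →₀ ℕ := Finsupp.equivFunOnFinite.symm p
  let e : ZMod k →₀ ℕ := Finsupp.equivFunOnFinite.symm fun j => if j = 1 then 0 else 1
  have he : ∏ j ∈ univ.erase (1 : ZMod k), MvPolynomial.X j =
      MvPolynomial.monomial e (1 : ℚ) := by
    rw [MvPolynomial.monomial_eq, Finsupp.prod_fintype _ _ (by simp), map_one, one_mul,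
      ← Finset.mul_prod_erase univ _ (mem_univ (1 : ZMod k))]
    simp only [e, Finsupp.equivFunOnFinite_symm_apply_apply, if_true, pow_zero, one_mul]
    exact Finset.prod_congr rfl fun j hj => by simp [(Finset.mem_erase.1 hj).1]
  have h := congrArg (MvPolynomial.coeff P) (sum_monomial_walkAbsorbed hk F)
  rw [he, Finset.sum_mul] at h
  simp only [MvPolynomial.monomial_mul, mul_one, MvPolynomial.coeff_sum,
    apply_ite (MvPolynomial.coeff P), MvPolynomial.coeff_zero, MvPolynomial.coeff_monomial] at h
  simp only [← ite_and, Finset.sum_boole] at h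
  have h' := Nat.cast_injective h
  rw [McardZ, Nat.card_eq_fintype_card, Nat.card_eq_fintype_card, Fintype.card_subtype,
    Fintype.card_subtype]
  convert h' using 2
  · ext S
    simp only [mem_filter, mem_univ, true_and, and_comm (a := WalkAbsorbed F S)]
    refine and_congr_left fun _ => ?_
    rw [Finsupp.ext_iff]
    simp only [tupleMultiplicity_apply]
    rfl
  · ext S
    simp only [mem_filter, mem_univ, true_and, Fintype.mem_piFinset, Finset.mem_erase, and_true]
    rw [and_comm]
    refine and_congr_right fun _ => ?_
    rw [Finsupp.ext_iff]
    simp only [Finsupp.add_apply, tupleMultiplicity_apply]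
    refine forall_congr' fun j => ?_
    change _ ↔ _ + (if j = 1 then 0 else 1) = p j
    split_ifs <;> omega

theorem card_tree_of_map {k r : ℕ} [NeZero k] (hk : 1 < k) (hr : 0 < r)
    (f : {i : ZMod k // i ≠ 0} → Fin r) (p : ZMod k → ℕ) :
    Nat.card {S : Fin r → Finset (ZMod k) // MprMem k r p S ∧ GIsTree k r (betaRel k) S f} =
      McardZ k (r - 1) (fun j => if j = 1 then (p j : ℤ) else (p j : ℤ) - 1) := by
  have : NeZero r := ⟨hr.ne'⟩
  let F : ZMod k → Fin r := fun l => if h : l ≠ 0 then f ⟨l, h⟩ else 0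
  have hF : (fun i : {i : ZMod k // i ≠ 0} => F i.1) = f := by
    funext i
    simp [F, i.2]
  rw [← card_walkAbsorbed hk F p]
  refine Nat.card_congr (Equiv.subtypeEquivRight fun S => ?_)
  rw [walkAbsorbed_iff, hF, MprMem, and_assoc]

/-- Theorem 1(b): for `S` uniform on `ℳ_{p,r}` and `f` an independent uniform surjection
`[k-1] → [r]`, the probability that `G_β(S,f)` is a tree equals
`|ℳ_{q,r-1}| / |ℳ_{p,r}|` where `q = (p_1, p_2 - 1, …, p_k - 1)`. -/
theorem prob_tree_beta (k r : ℕ) [NeZero k] (hr : 0 < r) (hrk : r < k)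
    (p : ZMod k → ℕ)
    (hM : Nonempty {S : Fin r → Finset (ZMod k) // MprMem k r p S}) :
    (Nat.card {om : OmM k r p // GIsTree k r (betaRel k) om.1.1 om.1.2} : ℚ) /
      (Nat.card (OmM k r p) : ℚ) =
    (McardZ k (r - 1) (fun j => if j = 1 then (p j : ℤ) else (p j : ℤ) - 1) : ℚ) /
      (Mcard k r p : ℚ) := by
  have hk : 1 < k := lt_of_le_of_lt hr hrk
  have hT : Nat.card {om : OmM k r p // GIsTree k r (betaRel k) om.1.1 om.1.2} =
      Nat.card {f : {i : ZMod k // i ≠ 0} → Fin r // Function.Surjective f} *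
        McardZ k (r - 1) (fun j => if j = 1 then (p j : ℤ) else (p j : ℤ) - 1) := by
    let e : {om : OmM k r p // GIsTree k r (betaRel k) om.1.1 om.1.2} ≃
        Σ f : {f : {i : ZMod k // i ≠ 0} → Fin r // Function.Surjective f},
          {S : Fin r → Finset (ZMod k) // MprMem k r p S ∧ GIsTree k r (betaRel k) S f.1} :=
      { toFun := fun om => ⟨⟨om.1.1.2, om.1.2.2⟩, ⟨om.1.1.1, om.1.2.1, om.2⟩⟩
        invFun := fun x => ⟨⟨(x.2.1, x.1.1), x.2.2.1, x.1.2⟩, x.2.2.2⟩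
        left_inv := fun _ => rfl
        right_inv := fun _ => rfl }
    classical
    rw [Nat.card_congr e, Nat.card_sigma, Finset.sum_congr rfl fun f _ =>
      card_tree_of_map hk hr f.1 p]
    simp
  have hO : Nat.card (OmM k r p) =
      Nat.card {f : {i : ZMod k // i ≠ 0} → Fin r // Function.Surjective f} * Mcard k r p := by
    rw [Mcard, mul_comm, ← Nat.card_prod]
    exact Nat.card_congr (Equiv.subtypeProdEquivProd (p := MprMem k r p))
  have hpos : (Nat.card {f : {i : ZMod k // i ≠ 0} → Fin r // Function.Surjective f} : ℚ) ≠ 0 := by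
    have : NeZero r := ⟨hr.ne'⟩
    have hcard : Fintype.card (Fin r) ≤ Fintype.card {i : ZMod k // i ≠ 0} := by
      rw [Fintype.card_subtype_compl, Fintype.card_subtype_eq, ZMod.card, Fintype.card_fin]
      omega
    obtain ⟨g⟩ := Function.Embedding.nonempty_of_card_le hcard
    have : Nonempty {f : {i : ZMod k // i ≠ 0} → Fin r // Function.Surjective f} :=
      ⟨⟨Function.invFun g, Function.invFun_surjective g.injective⟩⟩
    exact_mod_cast Nat.card_pos.ne'
  rw [hT, hO]
  push_cast
  rw [mul_div_mul_left _ _ hpos]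
end

section
/- Let k and r be positive integers with r < k, and let p = (p_1,…,p_k) be a tuple of non-negative integers such that M_{p,r} is non-empty. Let S = (S_1,…,S_r) be a uniformly random element of M_{p,r}, and let f be a uniformly random surjection from [k−1] onto [r], independent of S. Then the probability that the random digraph G_γ(S,f) is a tree equals Σ_{j=1}^{k} |M_{q^{(j)},r−1}| / |M_{p,r}|, where q^{(j)} = (q^{(j)}_1,…,q^{(j)}_k) with q^{(j)}_i = p_i − 1 for i ≠ j and q^{(j)}_j = p_j. -/
open Finset

section Gap

variable {k : ℕ}

/-- One less than the number of steps from `a` to `x` along the cycle, a full turn being made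
when `a = x`. -/
def gap (a x : ZMod k) : ℕ := (x - a - 1).val

lemma gap_succ (a : ZMod k) : gap a (a + 1) = 0 := by
  simp [gap]

lemma val_eq_of_cast {z : ZMod k} {n : ℕ} (hn : n < k) (h : (n : ZMod k) = z) : z.val = n := by
  rw [← h, ZMod.val_cast_of_lt hn]

variable [NeZero k]

lemma gap_lt (a x : ZMod k) : gap a x < k := ZMod.val_lt _

lemma gap_inj {a x y : ZMod k} : gap a x = gap a y ↔ x = y := by
  unfold gap
  rw [(ZMod.val_injective k).eq_iff]
  constructor
  · intro h; linear_combination h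
  · rintro rfl; rfl

lemma gap_cast (a x : ZMod k) : ((gap a x : ℕ) : ZMod k) = x - a - 1 := by
  simp [gap]

lemma gap_self (a : ZMod k) : gap a a = k - 1 := by
  have hk : 0 < k := Nat.pos_of_ne_zero (NeZero.ne k)
  apply val_eq_of_cast (by omega)
  rw [Nat.cast_sub (by omega)]
  simp

lemma gap_of_lt {a b x : ZMod k} (h : gap a b < gap a x) :
    gap b x = gap a x - gap a b - 1 := by
  have := gap_lt a x
  apply val_eq_of_cast (by omega)
  rw [Nat.cast_sub (by omega), Nat.cast_sub (by omega), gap_cast, gap_cast]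
  push_cast; ring

lemma gap_of_le {a b x : ZMod k} (h : gap a x ≤ gap a b) :
    gap b x = gap a x + k - gap a b - 1 := by
  have := gap_lt a b
  apply val_eq_of_cast (by omega)
  rw [Nat.cast_sub (by omega), Nat.cast_sub (by omega)]
  push_cast
  rw [gap_cast, gap_cast]
  simp

lemma gap_add_one {a l : ZMod k} (h : l ≠ a) : gap a (l + 1) = gap a l + 1 := by
  have h1 : gap a l ≠ gap a a := fun e => h (gap_inj.1 e)
  have h2 := gap_lt a l
  rw [gap_self] at h1
  apply val_eq_of_cast (by omega)
  push_cast
  rw [gap_cast]; ring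

/-- The cyclic interval `]a,j]`, read as the whole cycle when `a = j`. -/
def arc (a j : ZMod k) : Finset (ZMod k) := Finset.univ.filter fun x => gap a x ≤ gap a j

lemma mem_arc {a j x : ZMod k} : x ∈ arc a j ↔ gap a x ≤ gap a j := by simp [arc]

lemma arc_self (a : ZMod k) : arc a a = Finset.univ := by
  ext x
  have := gap_lt a x
  simp only [mem_arc, gap_self, Finset.mem_univ, iff_true]
  omega

lemma arc_succ (a : ZMod k) : arc a (a + 1) = {a + 1} := by
  ext x
  rw [mem_arc, gap_succ, Finset.mem_singleton, ← gap_inj (a := a), gap_succ]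
  omega

lemma arc_add_one {a l : ZMod k} (h : l ≠ a) : arc a (l + 1) = insert (l + 1) (arc a l) := by
  ext x
  rw [Finset.mem_insert, mem_arc, mem_arc, ← gap_inj (a := a), gap_add_one h]
  omega

lemma notMem_arc_of_ne {a l : ZMod k} (h : l ≠ a) : l + 1 ∉ arc a l := by
  rw [mem_arc, gap_add_one h]; omega

lemma arc_union_of_lt {a b j : ZMod k} (h : gap a b < gap a j) :
    arc a b ∪ arc b j = arc a j := by
  ext x
  rw [Finset.mem_union, mem_arc, mem_arc, mem_arc, gap_of_lt h]
  have := gap_lt a j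
  rcases lt_or_ge (gap a b) (gap a x) with h' | h'
  · rw [gap_of_lt h']; omega
  · rw [gap_of_le h']; omega

lemma arc_disjoint_of_lt {a b j : ZMod k} (h : gap a b < gap a j) :
    Disjoint (arc a b) (arc b j) := by
  rw [Finset.disjoint_left]
  intro x hx
  rw [mem_arc] at hx ⊢
  rw [gap_of_lt h, gap_of_le hx]
  have := gap_lt a j
  omega

lemma arc_union_of_le {a b j : ZMod k} (h : gap a j ≤ gap a b) :
    arc a b ∪ arc b j = Finset.univ := by
  ext x
  simp only [Finset.mem_union, mem_arc, Finset.mem_univ, iff_true]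
  rw [gap_of_le h]
  have := gap_lt a x
  rcases lt_or_ge (gap a b) (gap a x) with h' | h'
  · rw [gap_of_lt h']; omega
  · omega

lemma arc_inter_of_le {a b j : ZMod k} (h : gap a j ≤ gap a b) :
    arc a b ∩ arc b j = arc a j := by
  ext x
  simp only [Finset.mem_inter, mem_arc]
  rw [gap_of_le h]
  have := gap_lt a x
  have := gap_lt a b
  rcases lt_or_ge (gap a b) (gap a x) with h' | h'
  · omega
  · rw [gap_of_le h']; omega

lemma arc_disjoint_of_gap_le {a b i j : ZMod k} (hab : a ≠ b) (hi : gap a i ≤ gap a b)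
    (hj : gap b j ≤ gap b a) : Disjoint (arc a i) (arc b j) := by
  rw [Finset.disjoint_left]
  intro x hx hx'
  rw [mem_arc] at hx hx'
  have h1 : gap a b ≠ gap a a := fun e => hab (gap_inj.1 e).symm
  have h2 := gap_lt a b
  have h3 : gap a b < gap a a := by rw [gap_self] at h1 ⊢; omega
  have h4 := gap_of_lt h3
  have h5 := gap_of_le (hx.trans hi)
  rw [gap_self] at h3 h4
  omega

lemma cyc_eq_arc {i j : ZMod k} (h : i ≠ j) : cyc k i j = arc i j := by
  have key : ∀ x : ZMod k, x ≠ i → (x - i).val = gap i x + 1 := fun x hx => by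
    have h1 : gap i x ≠ gap i i := fun e => hx (gap_inj.1 e)
    have h2 := gap_lt i x
    rw [gap_self] at h1
    apply val_eq_of_cast (by omega)
    push_cast
    rw [gap_cast]; ring
  ext x
  simp only [cyc, Finset.mem_filter, Finset.mem_univ, true_and, mem_arc]
  rw [key j h.symm]
  by_cases hx : x = i
  · subst hx
    have h1 : gap x j ≠ gap x x := fun e => h (gap_inj.1 e).symm
    have h2 := gap_lt x j
    rw [gap_self] at h1 ⊢
    simp; omega
  · rw [key x hx]; omega

lemma cyc_self (i : ZMod k) : cyc k i i = ∅ := by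
  ext x
  simp only [cyc, Finset.mem_filter, Finset.mem_univ, true_and, sub_self, ZMod.val_zero,
    Finset.notMem_empty, iff_false]
  omega

end Gap

section Determinants

variable {V R : Type*} [Fintype V] [DecidableEq V] [CommRing R]

lemma det_one_sub_of_depth (N : Matrix V V R) (d : V → ℕ)
    (h : ∀ i j, N i j ≠ 0 → d j < d i) : (1 - N).det = 1 := by
  have hN : ∀ i j, d i ≤ d j → N i j = 0 := fun i j hij => by
    by_contra h0; exact absurd (h i j h0) (by omega)
  have hb : (1 - N).BlockTriangular (fun i => OrderDual.toDual (d i)) := by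
    intro i j hij
    have hij' : d i < d j := hij
    have : i ≠ j := by rintro rfl; omega
    simp [this, hN i j hij'.le]
  rw [hb.det]
  refine Finset.prod_eq_one fun a _ => ?_
  convert Matrix.det_one (n := {i // OrderDual.toDual (d i) = a}) (R := R)
  ext ⟨i, hi⟩ ⟨j, hj⟩
  have : d i = d j := OrderDual.toDual.injective (hi.trans hj.symm)
  simp [Matrix.toSquareBlock, Matrix.toSquareBlockProp, hN i j this.le, Matrix.one_apply]

lemma det_updateRow_of_mulVec_eq_single (N : Matrix V V R) (hN : N.det = 1) (o : V) (y z : V → R)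
    (hy : N.mulVec y = Pi.single o 1) : (N.updateRow o z).det = ∑ l, z l * y l := by
  have h1 : N.adjugate.mulVec (Pi.single o 1) = y := by
    rw [← hy, Matrix.mulVec_mulVec, Matrix.adjugate_mul, hN]; simp
  rw [← Matrix.cramer_transpose_apply, Matrix.cramer_eq_adjugate_mulVec,
    ← Matrix.adjugate_transpose, ← h1]
  simp [Matrix.mulVec, dotProduct, mul_comm, Pi.single_apply]

end Determinants

section GammaTree

variable {k : ℕ} {K : Type*} [Field K]

/-- The square matrix with a row of ones at index `0` and prescribed rows elsewhere. -/
def rootedMat (R : {i : ZMod k // i ≠ 0} → ZMod k → K) : Matrix (ZMod k) (ZMod k) K :=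
  fun i j => if h : i = 0 then 1 else R ⟨i, h⟩ j

lemma rootedMat_zero (R : {i : ZMod k // i ≠ 0} → ZMod k → K) (j : ZMod k) :
    rootedMat R 0 j = 1 := by simp [rootedMat]

lemma rootedMat_ne (R : {i : ZMod k // i ≠ 0} → ZMod k → K) (i : {i : ZMod k // i ≠ 0})
    (j : ZMod k) : rootedMat R i.1 j = R i j := by simp [rootedMat, i.2]

variable [NeZero k]

/-- The indicator of `]a,j] ⊆ S`. -/
def arcInd (K : Type*) [Field K] (S : Finset (ZMod k)) (a j : ZMod k) : K :=
  if arc a j ⊆ S then 1 else 0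

lemma exists_gammaRel {S : Finset (ZMod k)} (hS : S ≠ Finset.univ) (i : ZMod k) :
    ∃ j, gammaRel k S i j := by
  simp only [gammaRel, if_neg hS]
  by_cases hi : i ∈ S
  · exact ⟨i - 1, by simp [hi]⟩
  simp only [if_neg hi]
  have hne : (Sᶜ).Nonempty := by
    rwa [Finset.nonempty_iff_ne_empty, Ne, Finset.compl_eq_empty_iff]
  obtain ⟨x, hx, hmin⟩ := Finset.exists_min_image _ (fun x => gap i x) hne
  refine ⟨x - 1, by simpa using hx, ?_⟩
  by_cases hxi : x - 1 = i
  · rw [hxi, cyc_self]; simp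
  rw [cyc_eq_arc (Ne.symm hxi)]
  intro y hy
  rw [mem_arc] at hy
  by_contra hyS
  have h1 := hmin y (by simpa using hyS)
  have h2 := gap_add_one hxi
  rw [sub_add_cancel] at h2
  omega

lemma gammaRow_sub_succ (hk : 1 < k) {S : Finset (ZMod k)} (hS : S ≠ Finset.univ) {i g : ZMod k}
    (hg : gammaRel k S i g) (c : ZMod k) :
    (arcInd K S (i - 1) c - arcInd K S i c)
      - (arcInd K S (i - 1) (c + 1) - arcInd K S i (c + 1))
      = (if c = i then 1 else 0) - (if c = g then 1 else 0) := by
  have : Fact (1 < k) := ⟨hk⟩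
  have hsub : i - 1 ≠ i := fun e => one_ne_zero (α := ZMod k) (by linear_combination -e)
  have hii : arcInd K S i i = 0 := by
    rw [arcInd, if_neg]; rw [arc_self]; exact fun h => hS (Finset.univ_subset_iff.1 h)
  have h0 : gap (i - 1) i = 0 := by
    have := gap_succ (i - 1); rwa [sub_add_cancel] at this
  have harc : arc (i - 1) i = {i} := by
    have := arc_succ (i - 1); rwa [sub_add_cancel] at this
  rw [gammaRel, if_neg hS] at hg
  by_cases hi : i ∈ S
  · rw [if_pos hi] at hg
    subst hg
    have hrow : ∀ c, arcInd K S (i - 1) c - arcInd K S i c = if c = i then 1 else 0 := by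
      intro c
      by_cases hc : c = i
      · subst hc
        rw [hii, arcInd, harc, if_pos (by simpa using hi)]; simp
      · have hlt : gap (i - 1) i < gap (i - 1) c := by
          have : gap (i - 1) c ≠ gap (i - 1) i := fun e => hc (gap_inj.1 e)
          omega
        rw [if_neg hc, arcInd, arcInd, ← arc_union_of_lt hlt, harc]
        simp only [Finset.union_subset_iff, Finset.singleton_subset_iff, hi, true_and, sub_self]
    rw [hrow, hrow]
    simp only [eq_sub_iff_add_eq]
  · rw [if_neg hi] at hg
    have hz : ∀ c, arcInd K S (i - 1) c = 0 := fun c => by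
      rw [arcInd, if_neg]
      exact fun h => hi (h (mem_arc.2 (by omega)))
    rw [hz, hz]
    obtain ⟨hg1, hg2⟩ := hg
    have hstep : ∀ c, c ≠ i → (arc i (c + 1) ⊆ S ↔ c + 1 ∈ S ∧ arc i c ⊆ S) := fun c hc => by
      rw [arc_add_one hc, Finset.insert_subset_iff]
    have hsucc : arc i (i + 1) ⊆ S ↔ i + 1 ∈ S := by rw [arc_succ]; simp
    by_cases hc : c = i
    · subst hc
      rw [hii, arcInd]
      by_cases hcS : c + 1 ∈ S
      · have : c ≠ g := by rintro rfl; exact hg1 hcS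
        rw [if_pos (hsucc.2 hcS)]; simp [this]
      · have : c = g := by
          by_contra hne
          rw [cyc_eq_arc hne] at hg2
          exact hcS (hg2 (mem_arc.2 (by rw [gap_succ]; omega)))
        subst this
        rw [if_neg (fun h => hcS (hsucc.1 h))]; simp
    · have key : c = g ↔ arc i c ⊆ S ∧ c + 1 ∉ S := by
        constructor
        · rintro rfl
          rw [cyc_eq_arc (Ne.symm hc)] at hg2
          exact ⟨hg2, hg1⟩
        · rintro ⟨h1, h2⟩
          by_cases hgi : g = i
          · subst hgi
            exact absurd (h1 (mem_arc.2 (by rw [gap_succ]; omega))) hg1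
          rw [cyc_eq_arc (Ne.symm hgi)] at hg2
          have e1 : ¬ gap i (g + 1) ≤ gap i c := fun h => hg1 (h1 (mem_arc.2 h))
          have e2 : ¬ gap i (c + 1) ≤ gap i g := fun h => h2 (hg2 (mem_arc.2 h))
          rw [gap_add_one hgi] at e1
          rw [gap_add_one hc] at e2
          exact (gap_inj (a := i)).1 (by omega)
      simp only [arcInd, hstep c hc, key, if_neg hc]
      by_cases h1 : arc i c ⊆ S <;> by_cases h2 : c + 1 ∈ S <;> simp [h1, h2]

lemma det_one_sub_rooted (g : ZMod k → ZMod k) (T : Prop) [Decidable T]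
    (hT : T ↔ ∀ x, ∃ n : ℕ, g^[n] x = 0) :
    (1 - Matrix.of fun i j : ZMod k => if i ≠ 0 ∧ j ≠ 0 ∧ g i = j then (1 : K) else 0).det
      = if T then 1 else 0 := by
  classical
  split_ifs with h
  · rw [hT] at h
    apply det_one_sub_of_depth _ (fun x => Nat.find (h x))
    intro i j hij
    simp only [Matrix.of_apply, ne_eq, ite_eq_right_iff, one_ne_zero, imp_false, not_not] at hij
    obtain ⟨hi, -, rfl⟩ := hij
    have hs := Nat.find_spec (h i)
    have hpos : Nat.find (h i) ≠ 0 := fun e => by rw [e] at hs; exact hi hs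
    obtain ⟨n, hn⟩ := Nat.exists_eq_succ_of_ne_zero hpos
    rw [hn, Function.iterate_succ_apply] at hs
    have := Nat.find_min' (h (g i)) hs
    omega
  · rw [hT] at h
    push Not at h
    obtain ⟨x, hx⟩ := h
    rw [← Matrix.exists_mulVec_eq_zero_iff]
    refine ⟨fun y => if ∀ n : ℕ, g^[n] y ≠ 0 then 1 else 0, fun e => ?_, ?_⟩
    · have := congrFun e x
      simp [hx] at this
    · ext i
      rw [Matrix.sub_mulVec, Matrix.one_mulVec]
      simp only [Pi.sub_apply, Matrix.mulVec, dotProduct, Matrix.of_apply, Pi.zero_apply]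
      by_cases hi : i = 0
      · have : ¬ ∀ n : ℕ, g^[n] i ≠ 0 := fun h => h 0 hi
        rw [if_neg this]
        simp [hi]
      rw [Finset.sum_eq_single (g i) (fun b _ hb => by simp [Ne.symm hb]) (by simp)]
      have key : (∀ n : ℕ, g^[n] i ≠ 0) ↔ ∀ n : ℕ, g^[n] (g i) ≠ 0 := by
        constructor
        · exact fun h n => h (n + 1)
        · intro h n
          cases n with
          | zero => exact hi
          | succ n => exact h n
      by_cases h : ∀ n : ℕ, g^[n] (g i) ≠ 0
      · have h0 : g i ≠ 0 := h 0
        rw [if_pos (key.2 h), if_pos h, if_pos ⟨hi, h0, rfl⟩]; simp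
      · rw [if_neg (mt key.1 h), if_neg h]; simp

open Classical in
lemma det_gamma_eq_indicator (hk : 1 < k) {r : ℕ} (S : Fin r → Finset (ZMod k))
    (hS : ∀ t, S t ≠ Finset.univ) (f : {i : ZMod k // i ≠ 0} → Fin r) :
    (rootedMat fun i j => arcInd K (S (f i)) (i.1 - 1) j - arcInd K (S (f i)) i.1 j).det
      = if GIsTree k r (gammaRel k) S f then 1 else 0 := by
  have : Fact (1 < k) := ⟨hk⟩
  choose γ hγ using fun i : {i : ZMod k // i ≠ 0} => exists_gammaRel (hS (f i)) i.1
  let g : ZMod k → ZMod k := fun i => if h : i = 0 then 0 else γ ⟨i, h⟩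
  have hg : ∀ i : {i : ZMod k // i ≠ 0}, g i.1 = γ i := fun i => by simp [g, i.2]
  have hrow := fun (i : {i : ZMod k // i ≠ 0}) =>
    gammaRow_sub_succ (K := K) hk (hS (f i)) (hγ i)
  have htree : GIsTree k r (gammaRel k) S f ↔ ∀ x, ∃ n : ℕ, g^[n] x = 0 := by
    constructor
    · rintro ⟨g', h0, h1, h2⟩
      have : g' = g := by
        ext i
        by_cases hi : i = 0
        · simp [hi, h0, g]
        · rw [hg ⟨i, hi⟩]
          have e1 := gammaRow_sub_succ (K := ℚ) hk (hS (f ⟨i, hi⟩)) (hγ ⟨i, hi⟩) (g' i)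
          have e2 := gammaRow_sub_succ (K := ℚ) hk (hS (f ⟨i, hi⟩)) (h1 ⟨i, hi⟩) (g' i)
          rw [e1] at e2
          by_contra hne
          simp only [if_neg hne, if_true] at e2
          linarith
      rwa [← this]
    · exact fun h => ⟨g, by simp [g], fun i => by rw [hg]; exact hγ i, h⟩
  rw [← det_one_sub_rooted (K := K) g _ htree]
  set A := rootedMat fun i j => arcInd K (S (f i)) (i.1 - 1) j - arcInd K (S (f i)) i.1 j with hA
  have hD : (1 - Matrix.of fun j c : ZMod k => if c ≠ 0 ∧ j = c + 1 then (1 : K) else 0).det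
      = 1 := by
    apply det_one_sub_of_depth _ (fun j => gap 0 j)
    intro j c hjc
    simp only [Matrix.of_apply, ne_eq, ite_eq_right_iff, one_ne_zero, imp_false, not_not] at hjc
    rw [hjc.2, gap_add_one hjc.1]
    omega
  have hval : ∀ i c, (A * (1 - Matrix.of fun j c : ZMod k =>
      if c ≠ 0 ∧ j = c + 1 then (1 : K) else 0)) i c
      = A i c - if c ≠ 0 then A i (c + 1) else 0 := by
    intro i c
    rw [mul_sub, mul_one, Matrix.sub_apply, Matrix.mul_apply]
    by_cases hc : c = 0
    · simp [hc]
    · simp [hc]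
  rw [← congrArg (A.det * ·) hD |>.trans (mul_one _), ← Matrix.det_mul]
  apply Matrix.det_eq_of_forall_row_eq_smul_add_const (fun i => if i = 0 then 0 else A i 0 -
    if i = 0 then 1 else 0) 0 (by simp)
  intro i c
  rw [hval]
  by_cases hi : i = 0
  · subst hi
    by_cases hc : c = 0
    · subst hc; simp [hA, rootedMat_zero]
    · simp [hA, rootedMat_zero, hc, Ne.symm hc]
  · have hr := hrow ⟨i, hi⟩ c
    rw [← hg] at hr
    by_cases hc : c = 0
    · subst hc; simp [hi]
    · rw [hA, rootedMat_ne _ ⟨i, hi⟩, rootedMat_ne _ ⟨i, hi⟩, if_pos hc, hr]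
      simp [hi, hc, Matrix.one_apply, Ne.symm hc, eq_comm]

end GammaTree

section Expectation

variable {α : Type*} [Fintype α] [DecidableEq α] {K : Type*} [Field K]

/-- The weight of a tuple of sets in the generating function by the multiplicities. -/
def weight {r : ℕ} (X : α → K) (S : Fin r → Finset α) : K := ∏ t, ∏ x ∈ S t, X x

lemma sum_prod_superset (X : α → K) (b : Finset α) :
    ∑ s : Finset α, (∏ x ∈ s, X x) * (if b ⊆ s then 1 else 0)
      = ∏ x, if x ∈ b then X x else 1 + X x := by
  have h := Finset.prod_add X (fun x => if x ∈ b then (0 : K) else 1) (Finset.univ : Finset α)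
  have e : ∀ x, X x + (if x ∈ b then (0 : K) else 1) = if x ∈ b then X x else 1 + X x := by
    intro x; split_ifs <;> ring
  simp only [e, Finset.powerset_univ] at h
  rw [h]
  refine Finset.sum_congr rfl fun s _ => ?_
  congr 1
  split_ifs with hb
  · symm
    refine Finset.prod_eq_one fun x hx => ?_
    rw [if_neg]
    exact fun hxb => (Finset.mem_sdiff.1 hx).2 (hb hxb)
  · obtain ⟨x, hx, hxs⟩ := Finset.not_subset.1 hb
    symm
    exact Finset.prod_eq_zero (i := x) (by simp [hxs]) (by simp [hx])

lemma sum_weight_superset {r : ℕ} (X : α → K) (hX : ∀ x, 1 + X x ≠ 0)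
    (B : Finset (Fin r × α)) :
    ∑ S : Fin r → Finset α, weight X S * (if ∀ c ∈ B, c.2 ∈ S c.1 then 1 else 0)
      = (∏ x, (1 + X x)) ^ r * ∏ c ∈ B, X c.2 / (1 + X c.2) := by
  let b : Fin r → Finset α := fun t => Finset.univ.filter fun x => (t, x) ∈ B
  have h1 : ∀ S : Fin r → Finset α, weight X S * (if ∀ c ∈ B, c.2 ∈ S c.1 then 1 else 0)
      = ∏ t, ((∏ x ∈ S t, X x) * (if b t ⊆ S t then 1 else 0)) := by
    intro S
    rw [Finset.prod_mul_distrib, weight]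
    congr 1
    rw [Finset.prod_ite_zero]
    simp only [Finset.prod_const_one]
    congr 1
    simp only [Finset.mem_univ, true_imp_iff, b, Finset.subset_iff,
      Finset.mem_filter, true_and, Prod.forall]
  simp only [h1]
  have h2 := Finset.prod_univ_sum (fun _ : Fin r => (Finset.univ : Finset (Finset α)))
    (fun t s => (∏ x ∈ s, X x) * (if b t ⊆ s then (1 : K) else 0))
  rw [Fintype.piFinset_univ] at h2
  rw [← h2]
  simp only [sum_prod_superset]
  have h3 : ∀ t x, (if x ∈ b t then X x else 1 + X x)
      = (1 + X x) * if (t, x) ∈ B then X x / (1 + X x) else 1 := by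
    intro t x
    have := hX x
    simp only [b, Finset.mem_filter, Finset.mem_univ, true_and]
    split_ifs
    · field_simp
    · ring
  simp only [h3, Finset.prod_mul_distrib, Finset.prod_const, Finset.card_univ, Fintype.card_fin]
  rw [← Fintype.prod_prod_type' (fun t x => if (t, x) ∈ B then X x / (1 + X x) else 1)]
  congr 1
  simp only [Prod.mk.eta]
  rw [Finset.prod_ite_mem, Finset.univ_inter]

lemma sum_weight_ne_univ (X : α → K) (r : ℕ) :
    ∑ S : Fin r → Finset α, weight X S * (if ∀ t, S t ≠ Finset.univ then 1 else 0)
      = (∏ x, (1 + X x) - ∏ x, X x) ^ r := by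
  have h1 : ∀ S : Fin r → Finset α, weight X S * (if ∀ t, S t ≠ Finset.univ then 1 else 0)
      = ∏ t, ((∏ x ∈ S t, X x) * (if S t ≠ Finset.univ then 1 else 0)) := by
    intro S
    rw [Finset.prod_mul_distrib, weight, Finset.prod_ite_zero]
    simp
  simp only [h1]
  rw [← Fintype.sum_pow (fun s : Finset α => (∏ x ∈ s, X x) * (if s ≠ Finset.univ then 1 else 0))]
  congr 1
  have h2 := sum_prod_superset X ∅
  simp only [Finset.empty_subset, if_true, mul_one, Finset.notMem_empty, if_false] at h2
  rw [← h2, eq_sub_iff_add_eq]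
  have h3 : ∏ x, X x = ∑ s : Finset α, if s = Finset.univ then ∏ x ∈ s, X x else 0 := by simp
  rw [h3, ← Finset.sum_add_distrib]
  refine Finset.sum_congr rfl fun s _ => ?_
  by_cases hs : s = Finset.univ <;> simp [hs]

/-- Factors that involve disjoint sets of memberships have multiplicative mean. -/
lemma sum_weight_prod {r : ℕ} {ι : Type*} [Fintype ι] [DecidableEq ι] (X : α → K)
    (hX : ∀ x, 1 + X x ≠ 0) (B : ι → Finset (Fin r × α))
    (hB : ∀ i j, i ≠ j → Disjoint (B i) (B j)) (y z : ι → K) :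
    ∑ S : Fin r → Finset α, weight X S *
        ∏ i, (y i * (if ∀ c ∈ B i, c.2 ∈ S c.1 then 1 else 0) + z i)
      = (∏ x, (1 + X x)) ^ r * ∏ i, (y i * ∏ c ∈ B i, X c.2 / (1 + X c.2) + z i) := by
  have hsup := sum_weight_superset (r := r) X hX
  generalize ∏ x, (1 + X x) = Y at hsup ⊢
  simp only [Finset.prod_add, Finset.mul_sum]
  rw [Finset.sum_comm]
  refine Finset.sum_congr rfl fun s _ => ?_
  have h := hsup (s.biUnion B)
  rw [Finset.prod_biUnion (fun i _ j _ hij => hB i j hij)] at h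
  have h' : ∀ S : Fin r → Finset α,
      (∏ i ∈ s, (if ∀ c ∈ B i, c.2 ∈ S c.1 then (1 : K) else 0))
        = if ∀ c ∈ s.biUnion B, c.2 ∈ S c.1 then 1 else 0 := by
    intro S
    rw [Finset.prod_ite_zero, Finset.prod_const_one]
    congr 1
    simp only [Finset.mem_biUnion, eq_iff_iff]
    exact ⟨fun h c ⟨i, hi, hc⟩ => h i hi c hc, fun h i hi c hc => h c ⟨i, hi, hc⟩⟩
  simp only [Finset.prod_mul_distrib, h']
  calc _ = (∏ i ∈ s, y i) * (∏ i ∈ Finset.univ \ s, z i) * ∑ S : Fin r → Finset α,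
        weight X S * (if ∀ c ∈ s.biUnion B, c.2 ∈ S c.1 then 1 else 0) := by
        rw [Finset.mul_sum]
        exact Finset.sum_congr rfl fun S _ => by ring
    _ = _ := by rw [h]; ring

/-- The mean of a determinant whose rows involve disjoint sets of memberships. -/
lemma sum_weight_det {r : ℕ} {ι : Type*} [Fintype ι] [DecidableEq ι] (X : α → K)
    (hX : ∀ x, 1 + X x ≠ 0) (B : ι → ι → Finset (Fin r × α))
    (hB : ∀ i j, i ≠ j → ∀ a b, Disjoint (B i a) (B j b)) (y z : ι → ι → K) :
    ∑ S : Fin r → Finset α, weight X S *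
        (Matrix.of fun i j => y i j * (if ∀ c ∈ B i j, c.2 ∈ S c.1 then 1 else 0) + z i j).det
      = (∏ x, (1 + X x)) ^ r *
        (Matrix.of fun i j => y i j * ∏ c ∈ B i j, X c.2 / (1 + X c.2) + z i j).det := by
  simp only [← Matrix.det_transpose (Matrix.of _), Matrix.det_apply', Matrix.transpose_apply,
    Matrix.of_apply, Finset.mul_sum]
  rw [Finset.sum_comm]
  refine Finset.sum_congr rfl fun σ _ => ?_
  rw [mul_left_comm, ← sum_weight_prod X hX (fun i => B i (σ i)) (fun i j hij => hB i j hij _ _)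
    (fun i => y i (σ i)) (fun i => z i (σ i)), Finset.mul_sum]
  exact Finset.sum_congr rfl fun S _ => mul_left_comm _ _ _

end Expectation

section FixedColouring

variable {k : ℕ} [NeZero k] {K : Type*} [Field K] {r : ℕ}

/-- The product of `u` over `]a,j]`. -/
def arcProd (u : ZMod k → K) (a j : ZMod k) : K := ∏ x ∈ arc a j, u x

/-- The weighted matrix of the map `n` on nonzero indices; its row at `0` vanishes. -/
def nextMat (n : {i : ZMod k // i ≠ 0} → {i : ZMod k // i ≠ 0})
    (c : {i : ZMod k // i ≠ 0} → K) : Matrix (ZMod k) (ZMod k) K :=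
  fun i j => if hi : i = 0 then 0 else if j = (n ⟨i, hi⟩).1 then c ⟨i, hi⟩ else 0

/-- `n` sends each index to the index of the same colour whose label comes next on the cycle. -/
structure IsNext (f : {i : ZMod k // i ≠ 0} → Fin r) (h : {i : ZMod k // i ≠ 0} → ZMod k)
    (n : {i : ZMod k // i ≠ 0} → {i : ZMod k // i ≠ 0}) : Prop where
  colour : ∀ i, f (n i) = f i
  gap_le : ∀ i i', f i' = f i → gap (h i) (h (n i)) ≤ gap (h i) (h i')

variable {f : {i : ZMod k // i ≠ 0} → Fin r} {h : {i : ZMod k // i ≠ 0} → ZMod k}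
  {n : {i : ZMod k // i ≠ 0} → {i : ZMod k // i ≠ 0}}

lemma exists_isNext (f : {i : ZMod k // i ≠ 0} → Fin r) (h : {i : ZMod k // i ≠ 0} → ZMod k) :
    ∃ n, IsNext f h n := by
  have : ∀ i, ∃ i', f i' = f i ∧ ∀ i'', f i'' = f i → gap (h i) (h i') ≤ gap (h i) (h i'') := by
    intro i
    obtain ⟨i', h1, h2⟩ := Finset.exists_min_image (Finset.univ.filter fun i' => f i' = f i)
      (fun i' => gap (h i) (h i')) ⟨i, by simp⟩
    exact ⟨i', by simpa using h1, fun i'' hi'' => h2 i'' (by simpa using hi'')⟩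
  choose n h1 h2 using this
  exact ⟨n, h1, h2⟩

lemma IsNext.disjoint (hn : IsNext f h n) (hh : Function.Injective h)
    {i i' : {i : ZMod k // i ≠ 0}} (hii : i ≠ i') (hf : f i = f i') :
    Disjoint (arc (h i) (h (n i))) (arc (h i') (h (n i'))) :=
  arc_disjoint_of_gap_le (hh.ne hii) (hn.gap_le i i' hf.symm) (hn.gap_le i' i hf)

lemma prod_ite_eq_zero (c : K) : ∏ i : ZMod k, (if i = 0 then 1 else c) = c ^ (k - 1) := by
  rw [Finset.prod_ite]
  simp [Finset.filter_ne', Finset.card_erase_of_mem, ZMod.card]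

lemma det_rootedMat_smul (c : K) (R : {i : ZMod k // i ≠ 0} → ZMod k → K) :
    (rootedMat fun i j => c * R i j).det = c ^ (k - 1) * (rootedMat R).det := by
  have h1 : (rootedMat fun i j => c * R i j)
      = Matrix.of fun i j => (if i = 0 then 1 else c) * rootedMat R i j := by
    ext i j
    by_cases hi : i = 0 <;> simp [rootedMat, hi]
  rw [h1, Matrix.det_mul_column, prod_ite_eq_zero]

lemma one_sub_nextMat_mul_rootedMat (c : {i : ZMod k // i ≠ 0} → K)
    (R : {i : ZMod k // i ≠ 0} → ZMod k → K) :
    (1 - nextMat n c) * rootedMat R = rootedMat fun i j => R i j - c i * R (n i) j := by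
  ext i j
  rw [sub_mul, one_mul, Matrix.sub_apply, Matrix.mul_apply]
  by_cases hi : i = 0
  · simp [hi, nextMat, rootedMat_zero]
  · rw [rootedMat_ne _ ⟨i, hi⟩, rootedMat_ne _ ⟨i, hi⟩,
      Finset.sum_eq_single (n ⟨i, hi⟩).1 (fun b _ hb => by simp [nextMat, hi, hb]) (by simp),
      rootedMat_ne]
    simp [nextMat, hi]

lemma det_one_sub_nextMat_indicator (hn : IsNext f h n) (hf : Function.Surjective f)
    (S : Fin r → Finset (ZMod k)) :
    (1 - nextMat n fun i => arcInd K (S (f i)) (h i) (h (n i))).det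
      = if ∀ t, S t ≠ Finset.univ then 1 else 0 := by
  split_ifs with hS
  · have : ∀ t, ∃ x, x ∉ S t := fun t => by
      by_contra hc
      push Not at hc
      exact hS t (Finset.eq_univ_of_forall hc)
    choose x hx using this
    apply det_one_sub_of_depth _
      (fun i => if hi : i = 0 then 0 else gap (h ⟨i, hi⟩) (x (f ⟨i, hi⟩)))
    intro i j hij
    unfold nextMat at hij
    by_cases hi : i = 0
    · simp [hi] at hij
    by_cases hj : j = (n ⟨i, hi⟩).1
    · subst hj
      simp only [hi, dite_false, if_true, arcInd, ite_eq_right_iff, one_ne_zero, imp_false,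
        not_not, ne_eq] at hij
      have h1 : x (f ⟨i, hi⟩) ∉ arc (h ⟨i, hi⟩) (h (n ⟨i, hi⟩)) := fun hm => hx _ (hij hm)
      rw [mem_arc, not_le] at h1
      simp only [(n ⟨i, hi⟩).2, hi, dite_false, Subtype.coe_eta, hn.colour]
      rw [gap_of_lt h1]
      omega
    · simp [hi, hj] at hij
  · push Not at hS
    obtain ⟨t, ht⟩ := hS
    obtain ⟨i₀, hi₀⟩ := hf t
    rw [← Matrix.exists_mulVec_eq_zero_iff]
    refine ⟨fun i => if hi : i = 0 then 0 else if f ⟨i, hi⟩ = t then 1 else 0, fun e => ?_, ?_⟩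
    · have := congrFun e i₀.1
      simp [i₀.2, hi₀] at this
    · ext i
      rw [Matrix.sub_mulVec, Matrix.one_mulVec]
      simp only [Pi.sub_apply, Matrix.mulVec, dotProduct, Pi.zero_apply]
      by_cases hi : i = 0
      · simp [hi, nextMat]
      rw [Finset.sum_eq_single (n ⟨i, hi⟩).1 (fun b _ hb => by simp [nextMat, hi, hb]) (by simp)]
      simp only [nextMat, hi, dite_false, if_true, (n ⟨i, hi⟩).2, Subtype.coe_eta, hn.colour]
      by_cases hft : f ⟨i, hi⟩ = t
      · simp [hft, arcInd, ht]
      · simp [hft]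

/-- Cutting each row at the next label of the same colour does not change the determinant. -/
lemma det_cut (hn : IsNext f h n) (hh : Function.Injective h) (hf : Function.Surjective f)
    (S : Fin r → Finset (ZMod k)) :
    (rootedMat fun i j => arcInd K (S (f i)) (h i) j).det
      = (rootedMat fun i j => if gap (h i) j ≤ gap (h i) (h (n i))
          then arcInd K (S (f i)) (h i) j else 0).det := by
  by_cases hS : ∀ t, S t ≠ Finset.univ
  · have hdet := det_one_sub_nextMat_indicator (K := K) hn hf S
    rw [if_pos hS] at hdet
    rw [← one_mul (Matrix.det _), ← hdet, ← Matrix.det_mul, one_sub_nextMat_mul_rootedMat]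
    congr 2
    ext i j
    rw [hn.colour]
    split_ifs with hle
    · have hnot : ¬ (arc (h i) (h (n i)) ⊆ S (f i) ∧ arc (h (n i)) j ⊆ S (f i)) := by
        rw [← Finset.union_subset_iff, arc_union_of_le hle, Finset.univ_subset_iff]
        exact hS _
      have hz : arcInd K (S (f i)) (h i) (h (n i)) * arcInd K (S (f i)) (h (n i)) j = 0 := by
        rw [arcInd, arcInd, ite_zero_mul_ite_zero, if_neg hnot]
      rw [hz, sub_zero]
    · rw [not_le] at hle
      simp only [arcInd, ite_zero_mul_ite_zero, ← Finset.union_subset_iff, arc_union_of_lt hle,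
        mul_one, sub_self]
  · push Not at hS
    obtain ⟨t, ht⟩ := hS
    obtain ⟨i₀, hi₀⟩ := hf t
    have hone : ∀ i, f i = t → ∀ j, arcInd K (S (f i)) (h i) j = 1 := fun i hi j => by
      simp [arcInd, hi, ht]
    rw [Matrix.det_zero_of_row_eq (i := i₀.1) (j := 0) i₀.2
      (by ext j; rw [rootedMat_ne, rootedMat_zero, hone i₀ hi₀])]
    symm
    rw [← Matrix.exists_vecMul_eq_zero_iff]
    refine ⟨fun i => if hi : i = 0 then -1 else if f ⟨i, hi⟩ = t then 1 else 0, fun e => ?_, ?_⟩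
    · have := congrFun e 0
      simp at this
    · ext j
      obtain ⟨i₁, hi₁, hmin⟩ := Finset.exists_min_image (Finset.univ.filter fun i => f i = t)
        (fun i => gap (h i) j) ⟨i₀, by simpa using hi₀⟩
      have hi₁ : f i₁ = t := by simpa using hi₁
      have hcut : gap (h i₁) j ≤ gap (h i₁) (h (n i₁)) := by
        by_contra hlt
        rw [not_le] at hlt
        have h1 := hmin (n i₁) (by simp [hn.colour, hi₁])
        rw [gap_of_lt hlt] at h1
        omega
      simp only [Matrix.vecMul, dotProduct, Pi.zero_apply]
      rw [Fintype.sum_eq_add 0 i₁.1 i₁.2.symm]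
      · rw [rootedMat_zero, rootedMat_ne, if_pos hcut, hone i₁ hi₁]
        simp [i₁.2, hi₁]
      · rintro i ⟨hi, hne⟩
        by_cases hft : f ⟨i, hi⟩ = t
        · rw [rootedMat_ne _ ⟨i, hi⟩, if_neg, mul_zero]
          intro hle
          have hd := hn.disjoint hh (i := ⟨i, hi⟩) (i' := i₁)
            (fun e => hne (congrArg Subtype.val e)) (hft.trans hi₁.symm)
          exact Finset.disjoint_left.1 hd (mem_arc.2 hle) (mem_arc.2 hcut)
        · simp [hi, hft]

lemma sum_weight_det_rows (hn : IsNext f h n) (hh : Function.Injective h) (X : ZMod k → K)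
    (hX : ∀ x, 1 + X x ≠ 0) (A : {i : ZMod k // i ≠ 0} → ZMod k → Finset (ZMod k))
    (hA : ∀ i j, A i j ⊆ arc (h i) (h (n i))) (y z : ZMod k → ZMod k → K) :
    ∑ S : Fin r → Finset (ZMod k), weight X S *
        (Matrix.of fun i j => y i j *
          (if hi : i = 0 then 1 else if A ⟨i, hi⟩ j ⊆ S (f ⟨i, hi⟩) then 1 else 0) + z i j).det
      = (∏ x, (1 + X x)) ^ r * (Matrix.of fun i j => y i j *
          (if hi : i = 0 then 1 else ∏ x ∈ A ⟨i, hi⟩ j, X x / (1 + X x)) + z i j).det := by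
  let B : ZMod k → ZMod k → Finset (Fin r × ZMod k) := fun i j =>
    if hi : i = 0 then ∅ else {f ⟨i, hi⟩} ×ˢ A ⟨i, hi⟩ j
  have hB : ∀ i j, i ≠ j → ∀ a b, Disjoint (B i a) (B j b) := by
    intro i j hij a b
    by_cases hi : i = 0
    · simp [B, hi]
    by_cases hj : j = 0
    · simp [B, hj]
    simp only [B, hi, hj, dite_false]
    rw [Finset.disjoint_product]
    by_cases hfe : f ⟨i, hi⟩ = f ⟨j, hj⟩
    · right
      exact (hn.disjoint hh (fun e => hij (congrArg Subtype.val e)) hfe).mono (hA _ _) (hA _ _)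
    · left; simpa using hfe
  have hind : ∀ (S : Fin r → Finset (ZMod k)) (i j : ZMod k),
      (if hi : i = 0 then (1 : K) else if A ⟨i, hi⟩ j ⊆ S (f ⟨i, hi⟩) then 1 else 0)
        = if ∀ c ∈ B i j, c.2 ∈ S c.1 then 1 else 0 := by
    intro S i j
    by_cases hi : i = 0
    · simp [B, hi]
    · simp [B, hi, Finset.subset_iff]
  have hprod : ∀ i j : ZMod k,
      (if hi : i = 0 then (1 : K) else ∏ x ∈ A ⟨i, hi⟩ j, X x / (1 + X x))
        = ∏ c ∈ B i j, X c.2 / (1 + X c.2) := by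
    intro i j
    by_cases hi : i = 0
    · simp [B, hi]
    · simp only [B, hi, dite_false]
      rw [Finset.prod_product, Finset.prod_singleton]
  simp only [hind, hprod]
  exact sum_weight_det X hX B hB y z

lemma sum_weight_det_injective (hf : Function.Surjective f) (hh : Function.Injective h)
    (X : ZMod k → K) (hX : ∀ x, 1 + X x ≠ 0) :
    (1 - ∏ x, X x / (1 + X x)) ^ (k - 1) * ∑ S : Fin r → Finset (ZMod k), weight X S *
        (rootedMat fun i j => arcInd K (S (f i)) (h i) j).det
      = (∏ x, (1 + X x)) ^ r * (1 - ∏ x, X x / (1 + X x)) ^ r *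
        (rootedMat fun i => arcProd (fun x => X x / (1 + X x)) (h i)).det := by
  obtain ⟨n, hn⟩ := exists_isNext f h
  set u : ZMod k → K := fun x => X x / (1 + X x) with hu
  have hY : ∏ x, (1 + X x) ≠ 0 := Finset.prod_ne_zero_iff.2 fun x _ => hX x
  have hnext : (1 - nextMat n fun i => arcProd u (h i) (h (n i))).det = (1 - ∏ x, u x) ^ r := by
    have h1 := sum_weight_det_rows hn hh X hX (fun i _ => arc (h i) (h (n i)))
      (fun _ _ => le_rfl) (fun i j => if hi : i = 0 then 0 else if j = (n ⟨i, hi⟩).1 then -1 else 0)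
      (fun i j => (1 : Matrix _ _ K) i j)
    have h2 := sum_weight_ne_univ X r
    simp only [← det_one_sub_nextMat_indicator (K := K) hn hf] at h2
    have h3 : ∏ x, (1 + X x) - ∏ x, X x = (∏ x, (1 + X x)) * (1 - ∏ x, u x) := by
      simp only [hu, Finset.prod_div_distrib]
      field_simp
    rw [h3, mul_pow] at h2
    apply mul_left_cancel₀ (pow_ne_zero r hY)
    rw [← h2]
    convert h1.symm using 2
    · congr 1
      ext i j
      by_cases hi : i = 0
      · simp [nextMat, hi]
      · by_cases hj : j = (n ⟨i, hi⟩).1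
        · simp [nextMat, hi, hj, arcProd, hu]; ring
        · simp [nextMat, hi, hj]
    · congr 2
      ext i j
      by_cases hi : i = 0
      · simp [nextMat, hi]
      · by_cases hj : j = (n ⟨i, hi⟩).1
        · simp only [nextMat, hi, hj, arcInd, Matrix.sub_apply, Matrix.of_apply, dite_false,
            if_true]
          ring
        · simp [nextMat, hi, hj]
  have hcut : ∑ S : Fin r → Finset (ZMod k), weight X S *
        (rootedMat fun i j => arcInd K (S (f i)) (h i) j).det
      = (∏ x, (1 + X x)) ^ r * (rootedMat fun i j => if gap (h i) j ≤ gap (h i) (h (n i))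
          then arcProd u (h i) j else 0).det := by
    simp only [det_cut hn hh hf]
    have h1 := sum_weight_det_rows hn hh X hX
      (fun i j => if gap (h i) j ≤ gap (h i) (h (n i)) then arc (h i) j else ∅)
      (fun i j => by
        split_ifs with hle
        · exact fun x hx => mem_arc.2 ((mem_arc.1 hx).trans hle)
        · simp)
      (fun i j => if hi : i = 0 then 0 else
        if gap (h ⟨i, hi⟩) j ≤ gap (h ⟨i, hi⟩) (h (n ⟨i, hi⟩)) then 1 else 0)
      (fun i j => if i = 0 then 1 else 0)
    convert h1 using 2
    · congr 2
      ext i j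
      by_cases hi : i = 0
      · simp [hi, rootedMat]
      · by_cases hle : gap (h ⟨i, hi⟩) j ≤ gap (h ⟨i, hi⟩) (h (n ⟨i, hi⟩))
        · simp [hi, hle, rootedMat, arcInd]
        · simp [hi, hle, rootedMat]
    · congr 1
      ext i j
      by_cases hi : i = 0
      · simp [hi, rootedMat]
      · by_cases hle : gap (h ⟨i, hi⟩) j ≤ gap (h ⟨i, hi⟩) (h (n ⟨i, hi⟩))
        · simp [hi, hle, rootedMat, arcProd, hu]
        · simp [hi, hle, rootedMat]
  rw [hcut, mul_left_comm, ← det_rootedMat_smul, mul_assoc, ← hnext, ← Matrix.det_mul,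
    one_sub_nextMat_mul_rootedMat]
  congr 3
  ext i j
  split_ifs with hle
  · have := Finset.prod_union_inter (s₁ := arc (h i) (h (n i))) (s₂ := arc (h (n i)) j) (f := u)
    rw [arc_union_of_le hle, arc_inter_of_le hle] at this
    simp only [arcProd]
    rw [← this]; ring
  · rw [not_le] at hle
    have := Finset.prod_union (f := u) (arc_disjoint_of_lt hle)
    rw [arc_union_of_lt hle] at this
    simp only [arcProd]
    rw [this]; ring

end FixedColouring

section AverageOverColourings

variable {k : ℕ} [NeZero k] {K : Type*} [Field K] {r : ℕ}

lemma det_rootedMat_sub (R : {i : ZMod k // i ≠ 0} → ZMod k → ZMod k → K) :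
    (rootedMat fun i j => R i (i.1 - 1) j - R i i.1 j).det
      = ∑ b : ZMod k → Bool, (∏ i, if b i then (1 : K) else if i = 0 then 0 else -1) *
          (rootedMat fun i j => R i (if b i.1 then i.1 - 1 else i.1) j).det := by
  let g : ZMod k → Bool → ZMod k → K := fun i b =>
    (if b then (1 : K) else if i = 0 then 0 else -1) •
      fun j => if hi : i = 0 then 1 else R ⟨i, hi⟩ (if b then i - 1 else i) j
  have h1 : (rootedMat fun i j => R i (i.1 - 1) j - R i i.1 j) = fun i => ∑ b, g i b := by
    ext i j
    by_cases hi : i = 0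
    · simp [g, rootedMat, hi]
    · simp [g, rootedMat, hi, sub_eq_add_neg]
  rw [h1]
  have h2 := (Matrix.detRowAlternating (R := K) (n := ZMod k)).toMultilinearMap.map_sum g
  refine h2.trans (Finset.sum_congr rfl fun b _ => ?_)
  exact MultilinearMap.map_smul_univ _ _ _

lemma det_rootedMat_swap (R : {i : ZMod k // i ≠ 0} → ZMod k → K) {a b : {i : ZMod k // i ≠ 0}}
    (hab : a ≠ b) :
    (rootedMat fun i => R (Equiv.swap a b i)).det = -(rootedMat R).det := by
  have h1 : (rootedMat fun i => R (Equiv.swap a b i))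
      = (rootedMat R).submatrix (Equiv.swap a.1 b.1) id := by
    ext i j
    rw [Matrix.submatrix_apply, id]
    by_cases hi : i = 0
    · rw [hi, Equiv.swap_apply_of_ne_of_ne a.2.symm b.2.symm, rootedMat_zero, rootedMat_zero]
    · have h2 : Equiv.swap a.1 b.1 i = (Equiv.swap a b ⟨i, hi⟩).1 := by
        simp only [Equiv.swap_apply_def, Subtype.ext_iff]
        split_ifs <;> rfl
      rw [h2, rootedMat_ne, rootedMat_ne _ ⟨i, hi⟩]
  rw [h1, Matrix.det_permute, Equiv.Perm.sign_swap (Subtype.coe_injective.ne hab)]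
  simp

lemma sum_surjective_det_eq_zero [CharZero K] (Q : Fin r → ZMod k → ZMod k → K)
    (h : {i : ZMod k // i ≠ 0} → ZMod k) (hh : ¬ Function.Injective h) :
    ∑ f : {i : ZMod k // i ≠ 0} → Fin r with Function.Surjective f,
      (rootedMat fun i => Q (f i) (h i)).det = 0 := by
  simp only [Function.Injective, not_forall] at hh
  obtain ⟨a, b, hab, hne⟩ := hh
  rw [← self_eq_neg, ← Finset.sum_neg_distrib]
  have hswap : ∀ i, h (Equiv.swap a b i) = h i := fun i => by
    rw [Equiv.swap_apply_def]
    split_ifs with h1 h2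
    · rw [h1, hab]
    · rw [h2, hab]
    · rfl
  refine Finset.sum_equiv ((Equiv.swap a b).arrowCongr (Equiv.refl _)) (fun f => ?_) fun f _ => ?_
  · rw [Finset.mem_filter_univ, Finset.mem_filter_univ]
    exact ((Equiv.swap a b).symm.surjective_comp f).symm
  · have h1 := det_rootedMat_swap (fun i => Q (f i) (h i)) hne
    simp only [hswap] at h1
    simp [h1]

lemma sum_weight_det_sub [CharZero K] (X : ZMod k → K) (hX : ∀ x, 1 + X x ≠ 0) :
    (1 - ∏ x, X x / (1 + X x)) ^ (k - 1) *
      ∑ f : {i : ZMod k // i ≠ 0} → Fin r with Function.Surjective f,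
        ∑ S : Fin r → Finset (ZMod k), weight X S *
          (rootedMat fun i j => arcInd K (S (f i)) (i.1 - 1) j - arcInd K (S (f i)) i.1 j).det
      = (#{f : {i : ZMod k // i ≠ 0} → Fin r | Function.Surjective f} : K) *
        ((∏ x, (1 + X x)) ^ r * (1 - ∏ x, X x / (1 + X x)) ^ r *
        (rootedMat fun i j => arcProd (fun x => X x / (1 + X x)) (i.1 - 1) j
          - arcProd (fun x => X x / (1 + X x)) i.1 j).det) := by
  have key : ∀ h : {i : ZMod k // i ≠ 0} → ZMod k, (1 - ∏ x, X x / (1 + X x)) ^ (k - 1) *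
      ∑ f : {i : ZMod k // i ≠ 0} → Fin r with Function.Surjective f,
        ∑ S : Fin r → Finset (ZMod k), weight X S *
          (rootedMat fun i j => arcInd K (S (f i)) (h i) j).det
      = (#{f : {i : ZMod k // i ≠ 0} → Fin r | Function.Surjective f} : K) *
        ((∏ x, (1 + X x)) ^ r * (1 - ∏ x, X x / (1 + X x)) ^ r *
        (rootedMat fun i => arcProd (fun x => X x / (1 + X x)) (h i)).det) := by
    intro h
    by_cases hh : Function.Injective h
    · rw [Finset.mul_sum, ← nsmul_eq_mul]
      refine Finset.sum_eq_card_nsmul fun f hf => ?_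
      exact sum_weight_det_injective (by simpa using hf) hh X hX
    · rw [Finset.sum_comm]
      have h0 := fun S : Fin r → Finset (ZMod k) =>
        sum_surjective_det_eq_zero (fun t => arcInd K (S t)) h hh
      simp only [← Finset.mul_sum]
      simp only [Function.Injective, not_forall] at hh
      obtain ⟨a, b, hab, hne⟩ := hh
      rw [Matrix.det_zero_of_row_eq (i := a.1) (j := b.1) (Subtype.coe_injective.ne hne)
        (by ext j; rw [rootedMat_ne, rootedMat_ne, hab])]
      simp only [mul_zero]
      rw [Finset.sum_eq_zero, mul_zero]
      intro S _
      rw [← mul_zero (weight X S), ← h0 S]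
  have hexp := fun (f : {i : ZMod k // i ≠ 0} → Fin r) (S : Fin r → Finset (ZMod k)) =>
    det_rootedMat_sub fun i => arcInd K (S (f i))
  simp only [hexp, det_rootedMat_sub fun _ => arcProd _]
  have hcomm : ∀ (c : (ZMod k → Bool) → K) (D : ({i : ZMod k // i ≠ 0} → Fin r) →
      (Fin r → Finset (ZMod k)) → (ZMod k → Bool) → K),
      ∑ f : {i : ZMod k // i ≠ 0} → Fin r with Function.Surjective f,
        ∑ S : Fin r → Finset (ZMod k), weight X S * ∑ b, c b * D f S b
      = ∑ b, c b * ∑ f : {i : ZMod k // i ≠ 0} → Fin r with Function.Surjective f,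
        ∑ S : Fin r → Finset (ZMod k), weight X S * D f S b := by
    intro c D
    simp only [Finset.mul_sum]
    rw [Finset.sum_comm (s := Finset.univ (α := ZMod k → Bool))]
    refine Finset.sum_congr rfl fun f _ => ?_
    rw [Finset.sum_comm]
    exact Finset.sum_congr rfl fun b _ => Finset.sum_congr rfl fun S _ => by ring
  rw [hcomm, Finset.mul_sum, Finset.mul_sum, Finset.mul_sum]
  refine Finset.sum_congr rfl fun b _ => ?_
  rw [mul_left_comm, key fun i => if b i.1 then i.1 - 1 else i.1]
  ring

/-- The determinant of a bidiagonal matrix whose row at `0` is replaced by `z`. -/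
lemma det_bidiagonal (w z : ZMod k → K) :
    (Matrix.of fun i j : ZMod k => if i = 0 then z j else
      (if i = j then 1 else 0) - (if j = i - 1 then w i else 0)).det
      = ∑ l, z l * if l = 0 then 1 else ∏ x ∈ arc 0 l, w x := by
  let N : Matrix (ZMod k) (ZMod k) K :=
    Matrix.of fun i j => if i = 0 then 0 else if j = i - 1 then w i else 0
  have hN : (1 - N).det = 1 := by
    apply det_one_sub_of_depth _ (gap (-1))
    intro i j hij
    simp only [N, Matrix.of_apply, ne_eq, ite_eq_left_iff, ite_eq_right_iff, not_forall] at hij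
    obtain ⟨hi, rfl, -⟩ := hij
    have h1 := gap_add_one (a := (-1 : ZMod k)) (l := i - 1) (fun e => hi (by linear_combination e))
    rw [sub_add_cancel] at h1
    omega
  rw [← det_updateRow_of_mulVec_eq_single _ hN 0]
  · congr 1
    ext i j
    by_cases hi : i = 0
    · subst hi; simp
    · simp [hi, N, Matrix.one_apply]
  · ext i
    rw [Matrix.sub_mulVec, Matrix.one_mulVec]
    by_cases hi : i = 0
    · simp [hi, N, Matrix.mulVec, dotProduct]
    · have h1 : (if i = 0 then 1 else ∏ x ∈ arc 0 i, w x)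
          = w i * if i - 1 = 0 then 1 else ∏ x ∈ arc 0 (i - 1), w x := by
        rw [if_neg hi]
        split_ifs with h0
        · have h2 := arc_succ (0 : ZMod k)
          rw [zero_add, ← sub_eq_zero.1 h0] at h2
          rw [h2, Finset.prod_singleton, mul_one]
        · have h2 := arc_add_one h0
          have h3 := notMem_arc_of_ne h0
          rw [sub_add_cancel] at h2 h3
          rw [h2, Finset.prod_insert h3]
      rw [Pi.sub_apply, h1]
      simp only [N, Matrix.mulVec, dotProduct, Matrix.of_apply, hi, if_false, ite_mul, zero_mul,
        Finset.sum_ite_eq', Finset.mem_univ, if_true, sub_self, ne_eq, not_false_eq_true,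
        Pi.single_eq_of_ne]

lemma arcProd_sub_mul {u : ZMod k → K} (hu : ∀ x, u x ≠ 0) (a l : ZMod k) :
    arcProd u a l - arcProd u a (l + 1) * (u (l + 1))⁻¹ = if l = a then ∏ x, u x - 1 else 0 := by
  simp only [arcProd]
  split_ifs with h
  · rw [h, arc_self, arc_succ, Finset.prod_singleton, mul_inv_cancel₀ (hu _)]
  · rw [arc_add_one h, Finset.prod_insert (notMem_arc_of_ne h), mul_right_comm,
      mul_inv_cancel₀ (hu _), one_mul, sub_self]

lemma det_arcProd_sub (hk : 1 < k) {u : ZMod k → K} (hu : ∀ x, u x ≠ 0) :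
    (rootedMat fun i j => arcProd u (i.1 - 1) j - arcProd u i.1 j).det * (1 - ∏ x, (u x)⁻¹)
      = (1 - ∏ x, u x) ^ (k - 1) * ∑ x, (1 - (u x)⁻¹) := by
  have : Fact (1 < k) := ⟨hk⟩
  let G : Matrix (ZMod k) (ZMod k) K := Matrix.of fun i j =>
    if i = 0 then (if j = 0 then 1 else 0) - (if j = -1 then (u 0)⁻¹ else 0) else
      (if i = j then 1 else 0) - (if j = i - 1 then (u i)⁻¹ else 0)
  have hG : G.det = 1 - ∏ x, (u x)⁻¹ := by
    have h1 := arc_add_one (a := (0 : ZMod k)) (l := -1) (by simp)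
    have h2 := notMem_arc_of_ne (a := (0 : ZMod k)) (l := -1) (by simp)
    rw [neg_add_cancel] at h1 h2
    rw [arc_self] at h1
    have h3 : ∏ x, (u x)⁻¹ = (u 0)⁻¹ * ∏ x ∈ arc 0 (-1), (u x)⁻¹ := by
      rw [h1, Finset.prod_insert h2]
    rw [det_bidiagonal, h3]
    simp only [sub_mul, Finset.sum_sub_distrib, ite_mul, one_mul, zero_mul, Finset.sum_ite_eq',
      Finset.mem_univ, if_true, neg_eq_zero, one_ne_zero, if_false]
  have hZ := det_bidiagonal (fun _ => (1 : K)) fun l : ZMod k => 1 - (u (l + 1))⁻¹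
  simp only [Finset.prod_const_one, ite_self, mul_one] at hZ
  replace hZ := hZ.trans (Equiv.sum_comp (Equiv.addRight (1 : ZMod k)) fun x => 1 - (u x)⁻¹)
  have hrow : ∀ (v : ZMod k → K) l, ∑ j, v j * G j l = v l - v (l + 1) * (u (l + 1))⁻¹ := by
    intro v l
    have : ∀ j, G j l = (if j = l then 1 else 0) - if j = l + 1 then (u j)⁻¹ else 0 := by
      intro j
      have h1 : l = j - 1 ↔ j = l + 1 := by rw [eq_sub_iff_add_eq, eq_comm]
      by_cases hj : j = 0
      · subst hj
        simp only [G, Matrix.of_apply, if_true, ← h1, zero_sub, eq_comm (a := l)]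
      · simp only [G, Matrix.of_apply, hj, if_false, h1]
    simp [this, mul_sub, Finset.sum_sub_distrib]
  rw [← hG, ← Matrix.det_mul, ← hZ, ← prod_ite_eq_zero, ← Matrix.det_mul_column]
  congr 1
  ext i l
  rw [Matrix.mul_apply, hrow, Matrix.of_apply, Matrix.of_apply]
  by_cases hi : i = 0
  · simp [hi, rootedMat_zero]
  · rw [rootedMat_ne _ ⟨i, hi⟩, rootedMat_ne _ ⟨i, hi⟩]
    have h1 := arcProd_sub_mul hu i l
    have h2 := arcProd_sub_mul hu (i - 1) l
    simp only [hi, if_false, eq_comm (a := i) (b := l)]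
    calc _ = (if l = i - 1 then ∏ x, u x - 1 else 0) - (if l = i then ∏ x, u x - 1 else 0) := by
          rw [← h1, ← h2]; ring
      _ = _ := by split_ifs <;> ring

lemma det_arcInd_sub_eq_zero (S : Fin r → Finset (ZMod k)) {f : {i : ZMod k // i ≠ 0} → Fin r}
    (hf : Function.Surjective f) {t : Fin r} (ht : S t = Finset.univ) :
    (rootedMat fun i j => arcInd K (S (f i)) (i.1 - 1) j - arcInd K (S (f i)) i.1 j).det = 0 := by
  obtain ⟨i, rfl⟩ := hf t
  refine Matrix.det_eq_zero_of_row_eq_zero i.1 fun j => ?_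
  rw [rootedMat_ne]
  simp [arcInd, ht]

open Classical in
lemma sum_weight_tree [CharZero K] (hk : 1 < k) (hr : 0 < r) (X : ZMod k → K) (h0 : ∀ x, X x ≠ 0)
    (h1 : ∀ x, 1 + X x ≠ 0) (hne : ∏ x, (1 + X x) ≠ ∏ x, X x) :
    ∑ f : {i : ZMod k // i ≠ 0} → Fin r with Function.Surjective f,
      ∑ S : Fin r → Finset (ZMod k), weight X S *
        (if (∀ t, S t ≠ Finset.univ) ∧ GIsTree k r (gammaRel k) S f then 1 else 0)
    = (#{f : {i : ZMod k // i ≠ 0} → Fin r | Function.Surjective f} : K) *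
      ∑ j, ∑ S : Fin (r - 1) → Finset (ZMod k), (∏ x ∈ Finset.univ.erase j, X x) *
        (weight X S * if ∀ t, S t ≠ Finset.univ then 1 else 0) := by
  have hdet : ∀ f : {i : ZMod k // i ≠ 0} → Fin r, Function.Surjective f →
      ∀ S : Fin r → Finset (ZMod k),
      (if (∀ t, S t ≠ Finset.univ) ∧ GIsTree k r (gammaRel k) S f then (1 : K) else 0)
      = (rootedMat fun i j => arcInd K (S (f i)) (i.1 - 1) j - arcInd K (S (f i)) i.1 j).det := by
    intro f hf S
    by_cases hS : ∀ t, S t ≠ Finset.univ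
    · rw [det_gamma_eq_indicator hk S hS f]
      simp [hS]
    · rw [if_neg fun h => hS h.1]
      push Not at hS
      obtain ⟨t, ht⟩ := hS
      rw [det_arcInd_sub_eq_zero S hf ht]
  have hsum : ∑ f : {i : ZMod k // i ≠ 0} → Fin r with Function.Surjective f,
      ∑ S : Fin r → Finset (ZMod k), weight X S *
        (if (∀ t, S t ≠ Finset.univ) ∧ GIsTree k r (gammaRel k) S f then (1 : K) else 0)
      = ∑ f : {i : ZMod k // i ≠ 0} → Fin r with Function.Surjective f,
        ∑ S : Fin r → Finset (ZMod k), weight X S *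
          (rootedMat fun i j => arcInd K (S (f i)) (i.1 - 1) j - arcInd K (S (f i)) i.1 j).det :=
    Finset.sum_congr rfl fun f hf => Finset.sum_congr rfl fun S _ => by
      rw [hdet f (by simpa using hf)]
  have hA := sum_weight_det_sub (r := r) X h1
  have hB := det_arcProd_sub hk (u := fun x => X x / (1 + X x)) fun x => div_ne_zero (h0 x) (h1 x)
  have hY : ∏ x, (1 + X x) ≠ 0 := Finset.prod_ne_zero_iff.2 fun x _ => h1 x
  have hP : ∏ x, X x ≠ 0 := Finset.prod_ne_zero_iff.2 fun x _ => h0 x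
  have hz : ∀ x, 1 - (X x / (1 + X x))⁻¹ = -(X x)⁻¹ := fun x => by
    have := h0 x
    field_simp
    ring
  have herase : ∀ j, ∏ x ∈ Finset.univ.erase j, X x = (∏ x, X x) * (X j)⁻¹ := fun j => by
    rw [← Finset.mul_prod_erase _ _ (Finset.mem_univ j), mul_comm (X j), mul_assoc,
      mul_inv_cancel₀ (h0 j), mul_one]
  simp only [← Finset.mul_sum, sum_weight_ne_univ, ← Finset.sum_mul, herase]
  simp only [hz, Finset.sum_neg_distrib, Finset.prod_inv_distrib, Finset.prod_div_distrib] at hA hB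
  rw [hsum]
  generalize (∑ f : {i : ZMod k // i ≠ 0} → Fin r with Function.Surjective f, _ : K) = T at hA ⊢
  generalize (rootedMat fun i j => arcProd (fun x => X x / (1 + X x)) (i.1 - 1) j
          - arcProd (fun x => X x / (1 + X x)) i.1 j).det = D at hA hB
  generalize ∏ x, (1 + X x) = Y at *
  generalize ∏ x, X x = P at *
  generalize ∑ x, (X x)⁻¹ = Z at *
  obtain ⟨r, rfl⟩ := Nat.exists_eq_add_of_lt hr
  have hq : 1 - P / Y ≠ 0 := by
    rw [sub_ne_zero, ne_comm, Ne, div_eq_one_iff_eq hY]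
    exact hne.symm
  have hYP : Y - P = Y * (1 - P / Y) := by field_simp
  have hD : 1 - (P / Y)⁻¹ = -(Y * (1 - P / Y) * P⁻¹) := by field_simp; ring
  rw [hD] at hB
  have hB' : D * (Y * (1 - P / Y)) = (1 - P / Y) ^ (k - 1) * (P * Z) := by
    field_simp at hB ⊢
    linear_combination -hB
  apply mul_left_cancel₀ (pow_ne_zero (k - 1) hq)
  rw [hA, hYP, zero_add, Nat.add_sub_cancel]
  generalize 1 - P / Y = s at hB' ⊢
  linear_combination (_ * (Y * s) ^ r) * hB'

end AverageOverColourings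

section Counting

variable {k : ℕ} [NeZero k] {r : ℕ}

/-- The exponent of the monomial `weight X S`. -/
noncomputable def setCount (S : Fin r → Finset (ZMod k)) : ZMod k →₀ ℕ :=
  Finsupp.equivFunOnFinite.symm fun x => Nat.card {t : Fin r // x ∈ S t}

/-- The indicator of the complement of `j`, as a vector of exponents. -/
noncomputable def complSingle (j : ZMod k) : ZMod k →₀ ℕ :=
  Finsupp.equivFunOnFinite.symm fun x => if x = j then 0 else 1

lemma weight_eq_monomial {K : Type*} [Field K] [Algebra (MvPolynomial (ZMod k) ℚ) K]
    (S : Fin r → Finset (ZMod k)) :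
    weight (fun x => algebraMap (MvPolynomial (ZMod k) ℚ) K (MvPolynomial.X x)) S
      = algebraMap (MvPolynomial (ZMod k) ℚ) K (MvPolynomial.monomial (setCount S) 1) := by
  rw [MvPolynomial.monomial_eq, Finsupp.prod_fintype _ _ (by simp)]
  simp only [weight, map_one, one_mul, map_prod, map_pow, setCount,
    Finsupp.coe_equivFunOnFinite_symm, Nat.card_eq_fintype_card, Fintype.card_subtype]
  calc _ = ∏ t, ∏ x, if x ∈ S t then algebraMap (MvPolynomial (ZMod k) ℚ) K (MvPolynomial.X x)
        else 1 := by simp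
    _ = _ := by
      rw [Finset.prod_comm]
      exact Finset.prod_congr rfl fun x _ => by rw [Finset.prod_ite]; simp

lemma prod_erase_eq_monomial {K : Type*} [Field K] [Algebra (MvPolynomial (ZMod k) ℚ) K]
    (j : ZMod k) :
    ∏ x ∈ Finset.univ.erase j, algebraMap (MvPolynomial (ZMod k) ℚ) K (MvPolynomial.X x)
      = algebraMap (MvPolynomial (ZMod k) ℚ) K (MvPolynomial.monomial (complSingle j) 1) := by
  rw [MvPolynomial.monomial_eq, Finsupp.prod_fintype _ _ (by simp)]
  simp [complSingle, map_prod, Finset.prod_ite, Finset.filter_ne', pow_ite]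

open Classical in
lemma sum_setCount_tree (hk : 1 < k) (hr : 0 < r) (P : ZMod k →₀ ℕ) :
    ∑ f : {i : ZMod k // i ≠ 0} → Fin r with Function.Surjective f,
      ∑ S : Fin r → Finset (ZMod k), (if setCount S = P then (1 : ℚ) else 0) *
        (if (∀ t, S t ≠ Finset.univ) ∧ GIsTree k r (gammaRel k) S f then 1 else 0)
    = (#{f : {i : ZMod k // i ≠ 0} → Fin r | Function.Surjective f} : ℚ) *
      ∑ j, ∑ S : Fin (r - 1) → Finset (ZMod k),
        (if complSingle j + setCount S = P then 1 else 0) *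
          (if ∀ t, S t ≠ Finset.univ then 1 else 0) := by
  obtain ⟨K, _, _, hinj⟩ : ∃ (K : Type) (_ : Field K) (_ : Algebra (MvPolynomial (ZMod k) ℚ) K),
      Function.Injective (algebraMap (MvPolynomial (ZMod k) ℚ) K) :=
    ⟨FractionRing (MvPolynomial (ZMod k) ℚ), inferInstance, inferInstance,
      IsFractionRing.injective _ _⟩
  have hcz : CharZero K := charZero_of_injective_algebraMap hinj
  have hev : ∀ a b : MvPolynomial (ZMod k) ℚ,
      MvPolynomial.eval (fun _ => (0 : ℚ)) a ≠ MvPolynomial.eval (fun _ => 0) b →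
      algebraMap (MvPolynomial (ZMod k) ℚ) K a ≠ algebraMap (MvPolynomial (ZMod k) ℚ) K b :=
    fun a b hab e => hab (by rw [hinj e])
  have hmain := sum_weight_tree (K := K) hk hr
    (fun x => algebraMap (MvPolynomial (ZMod k) ℚ) K (MvPolynomial.X x))
    (fun x => by
      rw [Ne, map_eq_zero_iff _ hinj]
      exact MvPolynomial.X_ne_zero x)
    (fun x => by
      have := hev (1 + MvPolynomial.X x) 0 (by simp)
      simpa using this)
    (by
      have := hev (∏ x, (1 + MvPolynomial.X x)) (∏ x, MvPolynomial.X x)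
        (by simp [Finset.prod_eq_zero (Finset.mem_univ (0 : ZMod k))])
      simpa using this)
  have hite : ∀ (c : Prop) [Decidable c], (if c then (1 : K) else 0)
      = algebraMap (MvPolynomial (ZMod k) ℚ) K (if c then 1 else 0) :=
    fun c _ => by split_ifs <;> simp
  simp only [weight_eq_monomial, prod_erase_eq_monomial, hite] at hmain
  rw [← map_natCast (algebraMap (MvPolynomial (ZMod k) ℚ) K)] at hmain
  simp only [← map_mul, ← map_sum] at hmain
  have hcoeff := congrArg (MvPolynomial.coeff P) (hinj hmain)
  have hC : ∀ (c : Prop) [Decidable c], (if c then (1 : MvPolynomial (ZMod k) ℚ) else 0)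
      = MvPolynomial.C (if c then 1 else 0) :=
    fun c _ => by split_ifs <;> simp
  have hN : ∀ n : ℕ, (n : MvPolynomial (ZMod k) ℚ) = MvPolynomial.C (n : ℚ) := fun n => by simp
  have hmulC : ∀ (a : MvPolynomial (ZMod k) ℚ) (c : ℚ),
      MvPolynomial.coeff P (a * MvPolynomial.C c) = MvPolynomial.coeff P a * c := fun a c => by
    rw [mul_comm, MvPolynomial.coeff_C_mul, mul_comm]
  simp only [hC, hN, ← mul_assoc, MvPolynomial.monomial_mul, MvPolynomial.coeff_sum,
    MvPolynomial.coeff_C_mul, hmulC, MvPolynomial.coeff_monomial, mul_one] at hcoeff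
  exact hcoeff

lemma setCount_eq_iff (p : ZMod k → ℕ) (S : Fin r → Finset (ZMod k)) :
    setCount S = Finsupp.equivFunOnFinite.symm p ↔ SprMem k r p S := by
  simp only [DFunLike.ext_iff, setCount, Finsupp.coe_equivFunOnFinite_symm, SprMem]

lemma complSingle_add_setCount_eq_iff (p : ZMod k → ℕ) (j : ZMod k)
    (S : Fin r → Finset (ZMod k)) :
    complSingle j + setCount S = Finsupp.equivFunOnFinite.symm p ↔
      ∀ x, (Nat.card {t : Fin r // x ∈ S t} : ℤ) = if x = j then (p x : ℤ) else (p x : ℤ) - 1 := by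
  simp only [DFunLike.ext_iff, setCount, complSingle, Finsupp.add_apply,
    Finsupp.coe_equivFunOnFinite_symm]
  refine forall_congr' fun x => ?_
  split_ifs <;> omega

lemma card_surjective_pos (hr : 0 < r) (hrk : r < k) :
    0 < #{f : {i : ZMod k // i ≠ 0} → Fin r | Function.Surjective f} := by
  have hcard : Fintype.card (Fin r) ≤ Fintype.card {i : ZMod k // i ≠ 0} := by
    rw [Fintype.card_fin, Fintype.card_subtype_compl, ZMod.card, Fintype.card_unique]
    omega
  obtain ⟨e⟩ := Function.Embedding.nonempty_of_card_le hcard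
  have : Nonempty (Fin r) := ⟨⟨0, hr⟩⟩
  exact Finset.card_pos.2 ⟨Function.invFun e, by simpa using Function.invFun_surjective e.injective⟩

lemma card_OmM (p : ZMod k → ℕ) :
    Nat.card (OmM k r p)
      = Mcard k r p * #{f : {i : ZMod k // i ≠ 0} → Fin r | Function.Surjective f} := by
  rw [Nat.card_congr (Equiv.subtypeProdEquivProd (p := MprMem k r p)
    (q := Function.Surjective)), Nat.card_prod, Mcard]
  congr 1
  rw [Nat.card_eq_fintype_card, Fintype.card_subtype]

open Classical in
lemma card_tree_OmM (p : ZMod k → ℕ) :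
    (Nat.card {om : OmM k r p // GIsTree k r (gammaRel k) om.1.1 om.1.2} : ℚ)
      = ∑ f : {i : ZMod k // i ≠ 0} → Fin r with Function.Surjective f,
        ∑ S : Fin r → Finset (ZMod k),
          (if setCount S = Finsupp.equivFunOnFinite.symm p then (1 : ℚ) else 0) *
          (if (∀ t, S t ≠ Finset.univ) ∧ GIsTree k r (gammaRel k) S f then 1 else 0) := by
  rw [Nat.card_congr (Equiv.subtypeSubtypeEquivSubtypeInter
    (fun om : (Fin r → Finset (ZMod k)) × ({i : ZMod k // i ≠ 0} → Fin r) =>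
      MprMem k r p om.1 ∧ Function.Surjective om.2)
    fun om => GIsTree k r (gammaRel k) om.1 om.2), Nat.card_eq_fintype_card, Fintype.card_subtype,
    Finset.card_filter, Fintype.sum_prod_type_right, Finset.sum_filter]
  push_cast
  refine Finset.sum_congr rfl fun f _ => ?_
  split_ifs with hf
  · refine Finset.sum_congr rfl fun S _ => ?_
    rw [ite_zero_mul_ite_zero, mul_one]
    simp only [setCount_eq_iff, MprMem, hf, and_true, and_assoc]
  · simp [hf]

open Classical in
lemma McardZ_eq_sum (p : ZMod k → ℕ) (j : ZMod k) :
    (McardZ k r (fun x => if x = j then (p x : ℤ) else (p x : ℤ) - 1) : ℚ)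
      = ∑ S : Fin r → Finset (ZMod k),
        (if complSingle j + setCount S = Finsupp.equivFunOnFinite.symm p then 1 else 0) *
          (if ∀ t, S t ≠ Finset.univ then 1 else 0) := by
  rw [McardZ, Nat.card_eq_fintype_card, Fintype.card_subtype, Finset.card_filter]
  push_cast
  refine Finset.sum_congr rfl fun S _ => ?_
  rw [ite_zero_mul_ite_zero, mul_one]
  simp only [complSingle_add_setCount_eq_iff]

end Counting

/-- Theorem 1(c): for `S` uniform on `ℳ_{p,r}` and `f` an independent uniform surjection
`[k-1] → [r]`, the probability that `G_γ(S,f)` is a tree equals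
`Σ_{j=1}^{k} |ℳ_{q^{(j)},r-1}| / |ℳ_{p,r}|`, where `q^{(j)}_i = p_i - 1` for `i ≠ j`
and `q^{(j)}_j = p_j`. -/
theorem prob_tree_gamma (k r : ℕ) [NeZero k] (hr : 0 < r) (hrk : r < k)
    (p : ZMod k → ℕ)
    (hM : Nonempty {S : Fin r → Finset (ZMod k) // MprMem k r p S}) :
    (Nat.card {om : OmM k r p // GIsTree k r (gammaRel k) om.1.1 om.1.2} : ℚ) /
      (Nat.card (OmM k r p) : ℚ) =
    (∑ j : ZMod k,
        (McardZ k (r - 1) (fun x => if x = j then (p x : ℤ) else (p x : ℤ) - 1) : ℚ)) /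
      (Mcard k r p : ℚ) := by
  have hsurj : (#{f : {i : ZMod k // i ≠ 0} → Fin r | Function.Surjective f} : ℚ) ≠ 0 :=
    Nat.cast_ne_zero.2 (card_surjective_pos hr hrk).ne'
  rw [card_tree_OmM, sum_setCount_tree (by omega) hr, card_OmM]
  simp only [McardZ_eq_sum]
  rw [Nat.cast_mul, mul_comm (Mcard k r p : ℚ), mul_div_mul_left _ _ hsurj]
end
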